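/- arXiv:2108.06877 — 3 statements merged into one kernel-verified Lean document; each statement's English description precedes it below -/
import Mathlib

section
/- Let f : ℝⁿ → ℝ be real analytic on an open neighborhood U of 0 with f(0) = 0. Then there exist constants C > 0 and α > 0 such that for every c ∈ (0, C) and every integer k ≥ α, the function g(x) = f(x) − c‖x‖^{2k} has an isolated critical point at the origin, i.e. there is r₀ > 0 such that ∇g(x) ≠ 0 for all x with 0 < ‖x‖ < r₀. -/
open scoped Topology

namespace MvPowerSeries

section Adic

variable {σ k : Type*}

lemma coeff_eq_zero_of_mem_span_X_pow [CommRing k] {N : ℕ} {s : MvPowerSeries σ k}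
    (hs : s ∈ Ideal.span (Set.range (X : σ → MvPowerSeries σ k)) ^ N) {ν : σ →₀ ℕ}
    (hν : ν.degree < N) : coeff ν s = 0 := by
  suffices h : (N : ℕ∞) ≤ s.order from coeff_of_lt_order (lt_of_lt_of_le (by exact_mod_cast hν) h)
  clear hν
  induction N generalizing s with
  | zero => simp
  | succ N ih =>
    rw [pow_succ] at hs
    refine Submodule.mul_induction_on hs (fun a ha b hb => ?_) (fun a b ha hb => ?_)
    · have hb1 : 1 ≤ b.order := by
        rw [one_le_order_iff_constCoeff_eq_zero]
        have : Ideal.span (Set.range (X : σ → MvPowerSeries σ k)) ≤ RingHom.ker constantCoeff := by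
          rw [Ideal.span_le]
          rintro _ ⟨i, rfl⟩
          simp
        exact this hb
      push_cast
      exact (add_le_add (ih ha) hb1).trans le_order_mul
    · exact (le_min ha hb).trans min_order_le_add

lemma sub_truncTotal_mem_span_X_pow [Finite σ] [CommRing k] (N : ℕ) (s : MvPowerSeries σ k) :
    s - (truncTotal N s : MvPolynomial σ k) ∈
      Ideal.span (Set.range (X : σ → MvPowerSeries σ k)) ^ N := by
  set I := Ideal.span (Set.range (X : σ → MvPowerSeries σ k)) with hI
  have hmap : (MvPolynomial.idealOfVars σ k).map
      (MvPolynomial.coeToMvPowerSeries.ringHom (σ := σ) (R := k)) ≤ I := by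
    rw [MvPolynomial.idealOfVars, Ideal.map_span, Ideal.span_le]
    rintro _ ⟨_, ⟨i, rfl⟩, rfl⟩
    exact Ideal.subset_span ⟨i, by simp⟩
  obtain ⟨L, hL⟩ := IsPrecomplete.prec (inferInstance : IsPrecomplete I (MvPowerSeries σ k))
    (f := fun n => (truncTotal n s : MvPolynomial σ k)) (by
      intro m n hmn
      rw [SModEq.sub_mem]
      simp only [smul_eq_mul, Ideal.mul_top]
      have h := Ideal.mem_map_of_mem (MvPolynomial.coeToMvPowerSeries.ringHom (σ := σ) (R := k))
        (truncTotal_sub_truncTotal_mem_pow_idealOfVars (le_refl m) hmn s)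
      rw [Ideal.map_pow, map_sub] at h
      exact Ideal.pow_right_mono hmap m h)
  have hLs : L = s := by
    ext ν
    have h := hL (ν.degree + 1)
    rw [SModEq.sub_mem] at h
    simp only [smul_eq_mul, Ideal.mul_top] at h
    have h2 := coeff_eq_zero_of_mem_span_X_pow h (Nat.lt_succ_self _)
    rw [map_sub, MvPolynomial.coeff_coe, coeff_truncTotal _ (Nat.lt_succ_self _), sub_eq_zero] at h2
    exact h2.symm
  have h := (hL N).symm
  rw [SModEq.sub_mem] at h
  simpa [smul_eq_mul, Ideal.mul_top, hLs] using h

lemma mem_span_X_iff [Finite σ] [CommRing k] {s : MvPowerSeries σ k} :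
    s ∈ Ideal.span (Set.range (X : σ → MvPowerSeries σ k)) ↔ constantCoeff s = 0 := by
  refine ⟨fun h => ?_, fun h => ?_⟩
  · have := coeff_eq_zero_of_mem_span_X_pow (N := 1) (s := s) (by simpa using h) (ν := 0) (by simp)
    simpa using this
  · have h1 := sub_truncTotal_mem_span_X_pow 1 s
    have h2 : truncTotal 1 s = 0 := by
      ext ν
      by_cases hν : ν.degree < 1
      · rw [coeff_truncTotal _ hν]
        have : ν = 0 := by
          rw [Nat.lt_one_iff] at hν
          exact (Finsupp.degree_eq_zero_iff ν).1 hν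
        subst this
        simpa using h
      · rw [coeff_truncTotal_eq_zero _ (not_lt.1 hν)]; simp
    simpa [h2] using h1

lemma maximalIdeal_eq_span_X [Finite σ] [Field k] :
    IsLocalRing.maximalIdeal (MvPowerSeries σ k) = Ideal.span (Set.range X) := by
  ext s
  rw [mem_span_X_iff, IsLocalRing.mem_maximalIdeal, mem_nonunits_iff, isUnit_iff_constantCoeff,
    isUnit_iff_ne_zero, not_not]

/-- A derivation of a power series ring into a separated module is determined by its values on the
variables. -/
lemma derivation_eq_zero_of_X [Finite σ] [CommRing k] {M : Type*} [AddCommGroup M] [Module k M]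
    [Module (MvPowerSeries σ k) M] [IsScalarTower k (MvPowerSeries σ k) M]
    [IsHausdorff (Ideal.span (Set.range (X : σ → MvPowerSeries σ k))) M]
    (δ : Derivation k (MvPowerSeries σ k) M) (h : ∀ i, δ (X i) = 0) : δ = 0 := by
  set I := Ideal.span (Set.range (X : σ → MvPowerSeries σ k)) with hI
  have hpoly : ∀ p : MvPolynomial σ k, δ (p : MvPowerSeries σ k) = 0 := by
    intro p
    induction p using MvPolynomial.induction_on with
    | C a =>
      rw [MvPolynomial.coe_C]
      exact δ.map_algebraMap a
    | add p q hp hq => rw [MvPolynomial.coe_add, map_add, hp, hq, add_zero]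
    | mul_X p i hp =>
      rw [MvPolynomial.coe_mul, MvPolynomial.coe_X, Derivation.leibniz, hp, h]; simp
  have hpow : ∀ (N : ℕ) (s : MvPowerSeries σ k), s ∈ I ^ (N + 1) →
      δ s ∈ (I ^ N • ⊤ : Submodule (MvPowerSeries σ k) M) := by
    intro N
    induction N with
    | zero => intro s _; simp
    | succ N ih =>
      intro s hs
      rw [pow_succ] at hs
      refine Submodule.mul_induction_on hs (fun a ha b hb => ?_) (fun a b ha hb => ?_)
      · rw [Derivation.leibniz]
        refine add_mem (Submodule.smul_mem_smul ha trivial) ?_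
        rw [pow_succ', ← smul_eq_mul, Submodule.smul_assoc]
        exact Submodule.smul_mem_smul hb (ih a ha)
      · rw [map_add]; exact add_mem ha hb
  ext s
  refine IsHausdorff.haus (I := I) inferInstance _ fun N => ?_
  rw [SModEq.zero]
  have h1 := hpow N _ (sub_truncTotal_mem_span_X_pow (N + 1) s)
  rwa [map_sub, hpoly, sub_zero] at h1

lemma derivation_apply [Fintype σ] [CommRing k] {M : Type*} [AddCommGroup M] [Module k M]
    [Module (MvPowerSeries σ k) M] [IsScalarTower k (MvPowerSeries σ k) M]
    [IsHausdorff (Ideal.span (Set.range (X : σ → MvPowerSeries σ k))) M]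
    (δ : Derivation k (MvPowerSeries σ k) M) (s : MvPowerSeries σ k) :
    δ s = ∑ i, pderiv k i s • δ (X i) := by
  classical
  have h := derivation_eq_zero_of_X (δ - ∑ i, ((LinearMap.toSpanSingleton (MvPowerSeries σ k) M
    (δ (X i))).compDer (pderiv k i))) (by
      intro j
      have hsum : ∀ t : Finset σ, (∑ i ∈ t, ((LinearMap.toSpanSingleton (MvPowerSeries σ k) M
          (δ (X i))).compDer (pderiv k i))) (X j) = ∑ i ∈ t, pderiv k i (X j) • δ (X i) := by
        intro t
        induction t using Finset.induction_on with
        | empty => simp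
        | insert a t ha ih => rw [Finset.sum_insert ha, Finset.sum_insert ha, ← ih]; rfl
      rw [Derivation.sub_apply, hsum, Finset.sum_eq_single j]
      · simp
      · intro i _ hij
        rw [pderiv_X_of_ne hij.symm, zero_smul]
      · simp)
  have hsum : ∀ t : Finset σ, (∑ i ∈ t, ((LinearMap.toSpanSingleton (MvPowerSeries σ k) M
      (δ (X i))).compDer (pderiv k i))) s = ∑ i ∈ t, pderiv k i s • δ (X i) := by
    intro t
    induction t using Finset.induction_on with
    | empty => simp
    | insert a t ha ih => rw [Finset.sum_insert ha, Finset.sum_insert ha, ← ih]; rfl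
  have h2 := DFunLike.congr_fun h s
  rw [Derivation.sub_apply, hsum] at h2
  exact sub_eq_zero.1 h2

end Adic

end MvPowerSeries

namespace MvPowerSeries

section Constants

variable {σ k : Type*} [Field k]

/-- The part of a power series not involving the variable `X j`. -/
noncomputable def freePart (j : σ) (f : MvPowerSeries σ k) : MvPowerSeries σ k :=
  fun ν => if ν j = 0 then coeff ν f else 0

lemma coeff_freePart (j : σ) (f : MvPowerSeries σ k) (ν : σ →₀ ℕ) :
    coeff ν (freePart j f) = if ν j = 0 then coeff ν f else 0 := rfl

lemma pderiv_freePart_self (j : σ) (f : MvPowerSeries σ k) : pderiv k j (freePart j f) = 0 := by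
  ext ν
  rw [coeff_pderiv, coeff_freePart, if_neg (by simp)]
  simp

lemma pderiv_freePart_of_ne {i j : σ} (hij : i ≠ j) (f : MvPowerSeries σ k) :
    pderiv k i (freePart j f) = freePart j (pderiv k i f) := by
  ext ν
  rw [coeff_pderiv, coeff_freePart, coeff_freePart, coeff_pderiv]
  simp [hij]

lemma X_dvd_sub_freePart (j : σ) (f : MvPowerSeries σ k) : X j ∣ f - freePart j f := by
  rw [X_dvd_iff]
  intro ν hν
  simp [coeff_freePart, hν]

lemma freePart_mul (j : σ) (f g : MvPowerSeries σ k) :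
    freePart j (f * g) = freePart j f * freePart j g := by
  classical
  ext ν
  rw [coeff_freePart, coeff_mul, coeff_mul]
  split_ifs with hν
  · refine Finset.sum_congr rfl fun p hp => ?_
    have h := DFunLike.congr_fun (Finset.HasAntidiagonal.mem_antidiagonal.1 hp) j
    rw [Finsupp.add_apply, hν, Nat.add_eq_zero_iff] at h
    simp [coeff_freePart, h]
  · refine (Finset.sum_eq_zero fun p hp => ?_).symm
    have h := DFunLike.congr_fun (Finset.HasAntidiagonal.mem_antidiagonal.1 hp) j
    rw [Finsupp.add_apply] at h
    rw [coeff_freePart, coeff_freePart]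
    by_cases h1 : p.1 j = 0
    · rw [if_neg (c := p.2 j = 0) (by lia), mul_zero]
    · rw [if_neg h1, zero_mul]

lemma X_dvd_iff_freePart_eq_zero {j : σ} {f : MvPowerSeries σ k} :
    X j ∣ f ↔ freePart j f = 0 := by
  rw [X_dvd_iff, MvPowerSeries.ext_iff]
  simp [coeff_freePart]

lemma prime_X (j : σ) : Prime (X j : MvPowerSeries σ k) := by
  refine ⟨fun h0 => by
    simpa [coeff_X] using congrArg (coeff (Finsupp.single j 1)) h0, fun hu => ?_, fun a b h => ?_⟩
  · simpa using isUnit_iff_constantCoeff.1 hu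
  · rw [X_dvd_iff_freePart_eq_zero, freePart_mul, mul_eq_zero] at h
    simpa only [X_dvd_iff_freePart_eq_zero] using h

lemma eq_zero_of_forall_X_pow_dvd {j : σ} {f : MvPowerSeries σ k}
    (h : ∀ m : ℕ, X j ^ m ∣ f) : f = 0 := by
  ext ν
  exact (X_pow_dvd_iff.1 (h (ν j + 1))) ν (Nat.lt_succ_self _)

lemma pderiv_X_pow_mul (j : σ) (m : ℕ) (f : MvPowerSeries σ k) :
    pderiv k j (X j ^ (m + 1) * f) =
      X j ^ m * (((m + 1 : ℕ) : MvPowerSeries σ k) * f + X j * pderiv k j f) := by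
  rw [Derivation.leibniz, pderiv_pow, pderiv_X_self]
  simp only [smul_eq_mul, Nat.add_sub_cancel]
  push_cast
  ring

variable [CharZero k]

lemma natCast_mul_dvd {x f : MvPowerSeries σ k} (m : ℕ)
    (h : x ∣ ((m + 1 : ℕ) : MvPowerSeries σ k) * f) : x ∣ f := by
  have hu : IsUnit ((m + 1 : ℕ) : MvPowerSeries σ k) := by
    rw [isUnit_iff_constantCoeff, map_natCast, isUnit_iff_ne_zero]
    exact_mod_cast Nat.succ_ne_zero m
  exact (hu.dvd_mul_left).1 h

/-- One-variable version: a quotient `a / b` killed by `∂ⱼ` satisfies `a / b = α / β` with `α`, `β`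
free of `X j`, where moreover any other derivatives vanishing on `a` and `b` vanish on `α`, `β`. -/
lemma exists_const_fraction_single (j : σ) (T : Set σ) (hj : j ∉ T) (m : ℕ) :
    ∀ a b : MvPowerSeries σ k, ¬ X j ∣ b →
      (X j ^ m * b) * pderiv k j a = a * pderiv k j (X j ^ m * b) →
      (∀ i ∈ T, pderiv k i a = 0 ∧ pderiv k i (X j ^ m * b) = 0) →
      ∃ α β : MvPowerSeries σ k, β ≠ 0 ∧ (∀ i ∈ insert j T, pderiv k i α = 0 ∧ pderiv k i β = 0) ∧
        β * a = α * (X j ^ m * b) := by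
  have hX : Prime (X j : MvPowerSeries σ k) := prime_X j
  induction m with
  | zero =>
    intro a b hb hab hT
    simp only [pow_zero, one_mul] at hab hT ⊢
    refine ⟨freePart j a, freePart j b, ?_, ?_, ?_⟩
    · intro h0
      have := X_dvd_sub_freePart j b
      rw [h0, sub_zero] at this
      exact hb this
    · rintro i (rfl | hi)
      · exact ⟨pderiv_freePart_self _ _, pderiv_freePart_self _ _⟩
      · have hij : i ≠ j := fun h => hj (h ▸ hi)
        rw [pderiv_freePart_of_ne hij, pderiv_freePart_of_ne hij, (hT i hi).1, (hT i hi).2]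
        have : freePart j (0 : MvPowerSeries σ k) = 0 := by
          ext ν; simp [coeff_freePart]
        exact ⟨this, this⟩
    · rw [← sub_eq_zero]
      set w := freePart j b * a - freePart j a * b with hw
      have hwd : b * pderiv k j w = w * pderiv k j b := by
        rw [hw, map_sub, Derivation.leibniz, Derivation.leibniz, pderiv_freePart_self,
          pderiv_freePart_self]
        simp only [smul_eq_mul, mul_zero, add_zero]
        linear_combination freePart j b * hab
      have hw1 : X j ∣ w := by
        have : w = (a - freePart j a) * b - (b - freePart j b) * a := by rw [hw]; ring
        rw [this]
        exact dvd_sub ((X_dvd_sub_freePart j a).mul_right _) ((X_dvd_sub_freePart j b).mul_right _)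
      have hstep : ∀ m : ℕ, X j ^ (m + 1) ∣ w := by
        intro m
        induction m with
        | zero => simpa using hw1
        | succ m ih =>
          obtain ⟨v, hv⟩ := ih
          rw [hv, pderiv_X_pow_mul] at hwd
          have h1 : b * (((m + 1 : ℕ) : MvPowerSeries σ k) * v) =
              X j * (v * pderiv k j b - b * pderiv k j v) := by
            refine mul_left_cancel₀ (pow_ne_zero m hX.ne_zero) ?_
            linear_combination hwd
          have h2 : X j ∣ b * (((m + 1 : ℕ) : MvPowerSeries σ k) * v) := ⟨_, h1⟩
          rw [hv, pow_succ (X j) (m + 1)]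
          exact mul_dvd_mul_left _ (natCast_mul_dvd m ((hX.dvd_or_dvd h2).resolve_left hb))
      refine eq_zero_of_forall_X_pow_dvd (j := j) fun m => ?_
      exact (pow_dvd_pow _ (Nat.le_succ m)).trans (hstep m)
  | succ m ih =>
    intro a b hb hab hT
    have h1 : X j ∣ a := by
      rw [pderiv_X_pow_mul] at hab
      have h2 : b * (((m + 1 : ℕ) : MvPowerSeries σ k) * a) =
          X j * (b * pderiv k j a - a * pderiv k j b) := by
        refine mul_left_cancel₀ (pow_ne_zero m hX.ne_zero) ?_
        linear_combination -hab
      exact natCast_mul_dvd m ((hX.dvd_or_dvd ⟨_, h2⟩).resolve_left hb)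
    obtain ⟨a, rfl⟩ := h1
    have hD : ∀ (i : σ) (g : MvPowerSeries σ k), i ≠ j →
        pderiv k i (X j * g) = X j * pderiv k i g := by
      intro i g hij
      rw [Derivation.leibniz, pderiv_X_of_ne hij.symm]
      simp
    have hDj : ∀ g : MvPowerSeries σ k, pderiv k j (X j * g) = g + X j * pderiv k j g := by
      intro g
      rw [Derivation.leibniz, pderiv_X_self]
      simp [add_comm]
    have hp : X j ^ (m + 1) * b = X j * (X j ^ m * b) := by ring
    rw [hp] at hab hT ⊢
    obtain ⟨α, β, hβ, hαβ, h⟩ := ih a b hb (by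
      rw [hDj, hDj] at hab
      refine mul_left_cancel₀ (pow_ne_zero 2 hX.ne_zero) ?_
      linear_combination hab) (by
      intro i hi
      have hij : i ≠ j := fun h => hj (h ▸ hi)
      have h := hT i hi
      rw [hD i _ hij, hD i _ hij] at h
      exact ⟨(mul_eq_zero.1 h.1).resolve_left hX.ne_zero,
        (mul_eq_zero.1 h.2).resolve_left hX.ne_zero⟩)
    exact ⟨α, β, hβ, hαβ, by linear_combination X j * h⟩

/-- If the fraction `a / b` is killed by the partial derivatives in `T`, then it can be written as
a fraction of power series killed by these derivatives. -/
lemma exists_const_fraction (T : Finset σ) (a b : MvPowerSeries σ k) (hb : b ≠ 0)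
    (hab : ∀ j ∈ T, b * pderiv k j a = a * pderiv k j b) :
    ∃ α β : MvPowerSeries σ k, β ≠ 0 ∧ (∀ j ∈ T, pderiv k j α = 0 ∧ pderiv k j β = 0) ∧
      β * a = α * b := by
  classical
  induction T using Finset.induction_on with
  | empty => exact ⟨a, b, hb, by simp, mul_comm _ _⟩
  | insert j T hj ih =>
    obtain ⟨α, β, hβ, hT, h⟩ := ih fun i hi => hab i (Finset.mem_insert_of_mem hi)
    have hX : Prime (X j : MvPowerSeries σ k) := prime_X j
    have h1 : β * pderiv k j α = α * pderiv k j β := by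
      have h2 := congrArg (pderiv k j) h
      rw [Derivation.leibniz, Derivation.leibniz] at h2
      simp only [smul_eq_mul] at h2
      have h3 := hab j (Finset.mem_insert_self _ _)
      refine mul_left_cancel₀ (pow_ne_zero 2 hb) ?_
      linear_combination (-b * β) * h2 + β ^ 2 * h3 + (b * pderiv k j β + β * pderiv k j b) * h
    obtain ⟨m, b', hb', rfl⟩ : ∃ (m : ℕ) (b' : MvPowerSeries σ k), ¬ X j ∣ b' ∧
        β = X j ^ m * b' := by
      have : ∃ m : ℕ, ¬ X j ^ (m + 1) ∣ β := by
        by_contra! hcon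
        exact hβ (eq_zero_of_forall_X_pow_dvd (j := j)
          fun m => (pow_dvd_pow _ (Nat.le_succ m)).trans (hcon m))
      obtain ⟨b', h1, h2⟩ := FiniteMultiplicity.exists_eq_pow_mul_and_not_dvd
        (show FiniteMultiplicity (X j) β from this)
      exact ⟨_, b', h2, h1⟩
    obtain ⟨α', β', hβ', hT', h'⟩ := exists_const_fraction_single j (T : Set σ) (by simpa using hj)
      m α b' hb' h1 (fun i hi => hT i hi)
    refine ⟨α', β', hβ', fun i hi => hT' i (by simpa using hi), ?_⟩
    refine mul_left_cancel₀ hβ ?_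
    linear_combination β' * h + b * h'

end Constants

end MvPowerSeries

namespace MvPowerSeries

section Annihilated

variable {σ k : Type*} [Field k] [CharZero k]

/-- A nonzero algebraic element killed by the derivations extending `∂ⱼ`, `j ∈ T`, divides a nonzero
power series killed by these `∂ⱼ`. -/
lemma exists_const_eq_mul_aeval {F : Type*} [Field F] [Algebra k F]
    [Algebra (MvPowerSeries σ k) F] (hinj : Function.Injective (algebraMap (MvPowerSeries σ k) F))
    (T : Finset σ) (D : σ → Derivation k F F)
    (hD : ∀ j ∈ T, ∀ a, D j (algebraMap (MvPowerSeries σ k) F a) = algebraMap _ F (pderiv k j a))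
    {w : F} (hw0 : w ≠ 0) (hw : IsAlgebraic (MvPowerSeries σ k) w) (hDw : ∀ j ∈ T, D j w = 0) :
    ∃ a : MvPowerSeries σ k, a ≠ 0 ∧ (∀ j ∈ T, pderiv k j a = 0) ∧
      ∃ q : Polynomial (MvPowerSeries σ k),
        algebraMap _ F a = w * Polynomial.aeval w q := by
  classical
  obtain ⟨p, ⟨hp0, hpw⟩, hmin⟩ : ∃ p : Polynomial (MvPowerSeries σ k),
      (p ≠ 0 ∧ Polynomial.aeval w p = 0) ∧ ∀ q : Polynomial (MvPowerSeries σ k),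
        Polynomial.aeval w q = 0 → q.natDegree < p.natDegree → q = 0 := by
    have hex : ∃ d : ℕ, ∃ p : Polynomial (MvPowerSeries σ k),
        (p ≠ 0 ∧ Polynomial.aeval w p = 0) ∧ p.natDegree = d := by
      obtain ⟨p, hp⟩ := hw
      exact ⟨_, p, hp, rfl⟩
    obtain ⟨p, hp, hd⟩ := Nat.find_spec hex
    refine ⟨p, hp, fun q hq hlt => ?_⟩
    by_contra hq0
    rw [hd] at hlt
    exact Nat.find_min hex hlt ⟨q, ⟨hq0, hq⟩, rfl⟩
  have hd0 : p.natDegree ≠ 0 := by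
    intro h
    rw [Polynomial.eq_C_of_natDegree_eq_zero h, Polynomial.aeval_C,
      map_eq_zero_iff _ hinj] at hpw
    rw [Polynomial.eq_C_of_natDegree_eq_zero h, hpw, Polynomial.C_0] at hp0
    exact hp0 rfl
  set e := p.leadingCoeff with he
  have he0 : e ≠ 0 := Polynomial.leadingCoeff_ne_zero.2 hp0
  have hsum : ∀ q : Polynomial (MvPowerSeries σ k), q.natDegree ≤ p.natDegree →
      Polynomial.aeval w q = ∑ i ∈ Finset.range (p.natDegree + 1),
        algebraMap _ F (q.coeff i) * w ^ i := by
    intro q hq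
    rw [Polynomial.aeval_eq_sum_range' (Nat.lt_succ_of_le hq)]
    simp [Algebra.smul_def]
  have hcoeff : ∀ j ∈ T, ∀ i, e * pderiv k j (p.coeff i) = p.coeff i * pderiv k j e := by
    intro j hj
    set q : Polynomial (MvPowerSeries σ k) := ∑ i ∈ Finset.range p.natDegree,
      Polynomial.monomial i (e * pderiv k j (p.coeff i) - p.coeff i * pderiv k j e) with hq
    have hqc : ∀ i, q.coeff i = e * pderiv k j (p.coeff i) - p.coeff i * pderiv k j e := by
      intro i
      rw [hq, Polynomial.finsetSum_coeff]
      simp only [Polynomial.coeff_monomial]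
      rw [Finset.sum_ite_eq']
      split_ifs with h
      · rfl
      · rw [Finset.mem_range, not_lt] at h
        rcases h.eq_or_lt with h | h
        · rw [← h, Polynomial.coeff_natDegree, sub_self]
        · rw [Polynomial.coeff_eq_zero_of_natDegree_lt h]; simp
    have hqd : q.natDegree < p.natDegree := by
      rcases eq_or_ne q 0 with h0 | h0
      · rw [h0, Polynomial.natDegree_zero]
        exact Nat.pos_of_ne_zero hd0
      rw [Polynomial.natDegree_lt_iff_degree_lt h0, Polynomial.degree_lt_iff_coeff_zero]
      intro i hi
      rw [hqc]
      rcases hi.eq_or_lt with h | h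
      · rw [← h, Polynomial.coeff_natDegree, sub_self]
      · rw [Polynomial.coeff_eq_zero_of_natDegree_lt h]; simp
    have hq0 : q = 0 := by
      refine hmin q ?_ hqd
      rw [hsum q hqd.le]
      have h1 := congrArg (D j) hpw
      rw [hsum p le_rfl, map_sum, map_zero] at h1
      have h2 := hpw
      rw [hsum p le_rfl] at h2
      have h3 : ∀ i, D j (algebraMap _ F (p.coeff i) * w ^ i) =
          algebraMap _ F (pderiv k j (p.coeff i)) * w ^ i := by
        intro i
        rw [Derivation.leibniz, Derivation.leibniz_pow, hDw j hj, hD j hj]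
        simp [mul_comm]
      simp only [h3] at h1
      simp only [hqc, map_sub, map_mul, sub_mul, Finset.sum_sub_distrib]
      have h4 : ∑ i ∈ Finset.range (p.natDegree + 1), algebraMap _ F e *
          algebraMap _ F (pderiv k j (p.coeff i)) * w ^ i = 0 := by
        simp only [mul_assoc, ← Finset.mul_sum, h1, mul_zero]
      have h5 : ∑ i ∈ Finset.range (p.natDegree + 1), algebraMap _ F (p.coeff i) *
          algebraMap _ F (pderiv k j e) * w ^ i = 0 := by
        simp only [mul_right_comm, ← Finset.sum_mul, h2, zero_mul]
      rw [h4, h5, sub_zero]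
    intro i
    have := hqc i
    rw [hq0, Polynomial.coeff_zero] at this
    exact (sub_eq_zero.1 this.symm)
  have hc0 : p.coeff 0 ≠ 0 := by
    intro h
    have h1 := Polynomial.X_mul_divX_add p
    rw [h, Polynomial.C_0, add_zero] at h1
    have h2 : p.divX = 0 := by
      refine hmin _ ?_ ?_
      · rw [← h1, map_mul, Polynomial.aeval_X] at hpw
        exact (mul_eq_zero.1 hpw).resolve_left hw0
      · rw [Polynomial.natDegree_divX_eq_natDegree_tsub_one]
        lia
    rw [h2, mul_zero] at h1
    exact hp0 h1.symm
  choose α β hβ hαβ hfrac using fun i =>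
    exists_const_fraction T (p.coeff i) e he0 fun j hj => hcoeff j hj i
  set s := Finset.range (p.natDegree + 1) with hs
  set r : ℕ → MvPowerSeries σ k := fun i => α i * ∏ l ∈ s.erase i, β l with hr
  have hB : ∀ i ∈ s, (∏ l ∈ s, β l) * p.coeff i = e * r i := by
    intro i hi
    rw [← Finset.mul_prod_erase s β hi, hr]
    linear_combination (∏ l ∈ s.erase i, β l) * hfrac i
  have hB0 : (∏ l ∈ s, β l) ≠ 0 := Finset.prod_ne_zero_iff.2 fun l _ => hβ l
  have hrsum : ∑ i ∈ s, algebraMap _ F (r i) * w ^ i = 0 := by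
    have h1 : algebraMap _ F e * ∑ i ∈ s, algebraMap _ F (r i) * w ^ i = 0 := by
      rw [Finset.mul_sum, ← mul_zero (algebraMap _ F (∏ l ∈ s, β l)), ← hpw, hsum p le_rfl,
        Finset.mul_sum]
      refine Finset.sum_congr rfl fun i hi => ?_
      rw [← mul_assoc, ← mul_assoc, ← map_mul, ← map_mul, hB i hi]
    exact (mul_eq_zero.1 h1).resolve_left ((map_ne_zero_iff _ hinj).2 he0)
  refine ⟨r 0, ?_, ?_, -∑ i ∈ Finset.range p.natDegree, Polynomial.monomial i (r (i + 1)), ?_⟩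
  · intro h
    have h1 := hB 0 (by simp [hs])
    rw [h, mul_zero, mul_eq_zero] at h1
    exact h1.elim hB0 hc0
  · intro j hj
    have h1 : pderiv k j (∏ l ∈ s.erase 0, β l) = 0 := by
      refine Finset.prod_induction β (fun b => pderiv k j b = 0) ?_ pderiv_one
        fun l _ => (hαβ l j hj).2
      intro a b ha hb
      rw [Derivation.leibniz, ha, hb]; simp
    rw [hr, Derivation.leibniz, h1, (hαβ 0 j hj).1]
    simp
  · rw [hs, Finset.sum_range_succ'] at hrsum
    rw [map_neg, map_sum]
    simp only [Polynomial.aeval_monomial]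
    rw [mul_neg, Finset.mul_sum, eq_neg_iff_add_eq_zero, ← hrsum, add_comm]
    simp only [pow_zero, mul_one, pow_succ]
    congr 1
    exact Finset.sum_congr rfl fun i _ => by ring

end Annihilated

end MvPowerSeries

/-- A derivation of a domain of characteristic zero extends to algebraic field extensions. -/
lemma Derivation.exists_extension_of_isAlgebraic {k A F : Type*} [Field k] [CharZero k]
    [CommRing A] [IsDomain A] [Algebra k A] [Field F] [Algebra k F] [Algebra A F]
    [IsScalarTower k A F] [FaithfulSMul A F] [Algebra.IsAlgebraic A F] (D : Derivation k A A) :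
    ∃ D' : Derivation k F F, ∀ a, D' (algebraMap A F a) = algebraMap A F (D a) := by
  let K := FractionRing A
  let _ : Algebra K F := FractionRing.liftAlgebra A F
  have _ : IsScalarTower A K F := FractionRing.isScalarTower_liftAlgebra A F
  have _ : CharZero A := charZero_of_injective_algebraMap (algebraMap k A).injective
  have _ : CharZero K := charZero_of_injective_algebraMap (IsFractionRing.injective A K)
  have _ : Algebra.IsAlgebraic K F := (IsFractionRing.comap_isAlgebraic_iff (A := A)).1 inferInstance
  have _ : Algebra.FormallyEtale A K := Algebra.FormallyEtale.of_isLocalization (nonZeroDivisors A)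
  have _ : Algebra.FormallyEtale K F := Algebra.FormallyEtale.of_isSeparable K F
  have _ : Algebra.FormallyEtale A F := Algebra.FormallyEtale.comp A K F
  let l : Ω[A⁄k] →ₗ[A] F := (Algebra.linearMap A F).comp D.liftKaehlerDifferential
  let e := KaehlerDifferential.tensorKaehlerEquivOfFormallyEtale k A F
  refine ⟨((l.liftBaseChange F).comp e.symm.toLinearMap).compDer (KaehlerDifferential.D k F),
    fun a => ?_⟩
  change l.liftBaseChange F (e.symm (KaehlerDifferential.D k F (algebraMap A F a))) = _
  rw [KaehlerDifferential.tensorKaehlerEquivOfFormallyEtale_symm_D_algebraMap]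
  simp [l]

namespace MvPowerSeries

/-- The chain rule for a derivation of a field containing a finite extension of a power series
ring, itself a quotient of a power series ring. -/
lemma derivation_algebraMap_apply {σ τ k F : Type*} [Fintype σ] [Field k] [Field F] [Algebra k F]
    [Algebra (MvPowerSeries τ k) (MvPowerSeries σ k)] [Algebra (MvPowerSeries τ k) F]
    [Algebra (MvPowerSeries σ k) F] [IsScalarTower (MvPowerSeries τ k) (MvPowerSeries σ k) F]
    [IsScalarTower k (MvPowerSeries σ k) F]
    (t : Set F) (hfin : t.Finite)
    (ht : ∀ s, algebraMap (MvPowerSeries σ k) F s ∈ Submodule.span (MvPowerSeries τ k) t)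
    (D : Derivation k F F)
    (hD : ∀ a, ∃ b, D (algebraMap (MvPowerSeries τ k) F a) = algebraMap (MvPowerSeries τ k) F b)
    (s : MvPowerSeries σ k) :
    D (algebraMap _ F s) = ∑ i, algebraMap _ F (pderiv k i s) *
      D (algebraMap (MvPowerSeries σ k) F (X i)) := by
  let N : Submodule (MvPowerSeries σ k) F := Submodule.span _ (t ∪ D '' t)
  have hN : ∀ x ∈ Submodule.span (MvPowerSeries τ k) t, x ∈ N ∧ D x ∈ N := by
    intro x hx
    induction hx using Submodule.span_induction with
    | mem x hx =>
      exact ⟨Submodule.subset_span (Or.inl hx), Submodule.subset_span (Or.inr ⟨x, hx, rfl⟩)⟩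
    | zero => simp
    | add x y _ _ hx hy => exact ⟨add_mem hx.1 hy.1, by rw [map_add]; exact add_mem hx.2 hy.2⟩
    | smul a x _ hx =>
      have hsm : ∀ (a : MvPowerSeries τ k) (y : F), y ∈ N → a • y ∈ N := by
        intro a y hy
        rw [← algebraMap_smul (MvPowerSeries σ k) a y]
        exact N.smul_mem _ hy
      refine ⟨hsm _ _ hx.1, ?_⟩
      obtain ⟨b, hb⟩ := hD a
      rw [Algebra.smul_def, Derivation.leibniz, hb, smul_eq_mul, smul_eq_mul, mul_comm x,
        ← Algebra.smul_def, ← Algebra.smul_def]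
      exact add_mem (hsm _ _ hx.2) (hsm _ _ hx.1)
  have _ : Module.Finite (MvPowerSeries σ k) N :=
    Module.Finite.of_fg (Submodule.fg_span (hfin.union (hfin.image D)))
  have _ : IsHausdorff (Ideal.span (Set.range (X : σ → MvPowerSeries σ k))) N := by
    rw [← maximalIdeal_eq_span_X]
    refine IsHausdorff.of_isLocalRing _ _ ?_
    exact Ideal.IsPrime.ne_top inferInstance
  let DS : Derivation k (MvPowerSeries σ k) F := D.compAlgebraMap (MvPowerSeries σ k)
  have hDS : ∀ s, DS s ∈ N := fun s => (hN _ (ht s)).2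
  let δ : Derivation k (MvPowerSeries σ k) N :=
    { toLinearMap := LinearMap.codRestrict (N.restrictScalars k) DS.toLinearMap hDS
      map_one_eq_zero' := Subtype.ext DS.map_one_eq_zero
      leibniz' := fun a b => Subtype.ext (DS.leibniz a b) }
  have h := congrArg N.subtype (derivation_apply δ s)
  rw [map_sum] at h
  refine h.trans (Finset.sum_congr rfl fun i _ => ?_)
  rw [map_smul, Algebra.smul_def]
  rfl

end MvPowerSeries

lemma Ideal.mem_smul_top_pi {A ι : Type*} [CommRing A] [Finite ι] {I : Ideal A} {x : ι → A}
    (hx : ∀ i, x i ∈ I) : x ∈ (I • ⊤ : Submodule A (ι → A)) := by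
  classical
  cases nonempty_fintype ι
  have h : x = ∑ i, x i • (Pi.single i 1 : ι → A) := by
    ext j
    simp [Finset.sum_apply, Pi.single_apply]
  rw [h]
  exact Submodule.sum_mem _ fun i _ => Submodule.smul_mem_smul (hx i) trivial

lemma IsPrecomplete.pi {A ι : Type*} [CommRing A] [Finite ι] (I : Ideal A) [IsPrecomplete I A] :
    IsPrecomplete I (ι → A) := by
  refine ⟨fun f hf => ?_⟩
  have hproj : ∀ (m : ℕ) (x : ι → A), x ∈ (I ^ m • ⊤ : Submodule A (ι → A)) → ∀ i,
      x i ∈ I ^ m := by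
    intro m x hx i
    refine Submodule.smul_induction_on (p := fun x : ι → A => x i ∈ I ^ m) hx ?_ ?_
    · intro r hr y _
      exact Ideal.mul_mem_right _ _ hr
    · intro y z hy hz
      exact add_mem hy hz
  have hlim : ∀ i, ∃ L : A, ∀ m, f m i ≡ L [SMOD (I ^ m • ⊤ : Submodule A A)] := by
    intro i
    refine IsPrecomplete.prec' (I := I) (fun m => f m i) fun {m n} hmn => ?_
    have h := hf hmn
    rw [SModEq.sub_mem] at h ⊢
    simpa using hproj m _ h i
  choose L hL using hlim
  refine ⟨L, fun m => ?_⟩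
  rw [SModEq.sub_mem]
  refine Ideal.mem_smul_top_pi fun i => ?_
  have h := hL i m
  rw [SModEq.sub_mem] at h
  simpa using h

lemma ringKrullDim_le_of_isIntegral (A B : Type*) [CommRing A] [CommRing B] [Algebra A B]
    [Algebra.IsIntegral A B] : ringKrullDim B ≤ ringKrullDim A := by
  refine Order.krullDim_le_of_strictMono (PrimeSpectrum.comap (algebraMap A B)) fun p q hpq => ?_
  exact Ideal.IsIntegral.comap_lt_comap (I := p.asIdeal) (J := q.asIdeal) hpq

namespace MvPowerSeries

variable {σ τ k : Type*} [Finite σ] [Finite τ] [Field k]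

/-- A quotient of a power series ring is finite over another one as soon as the images of the
variables generate an ideal which is primary to the maximal ideal. -/
lemma module_finite_quotient [Algebra (MvPowerSeries τ k) (MvPowerSeries σ k)]
    [IsScalarTower k (MvPowerSeries τ k) (MvPowerSeries σ k)]
    (Q : Ideal (MvPowerSeries σ k)) [Q.IsPrime]
    (hX : ∀ i, constantCoeff (algebraMap (MvPowerSeries τ k) (MvPowerSeries σ k) (X i)) = 0)
    {N : ℕ} (hN : Ideal.span (Set.range X) ^ N ≤
      Q ⊔ (Ideal.span (Set.range X)).map (algebraMap (MvPowerSeries τ k) (MvPowerSeries σ k))) :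
    Module.Finite (MvPowerSeries τ k) (MvPowerSeries σ k ⧸ Q) := by
  classical
  set A := MvPowerSeries τ k
  set S := MvPowerSeries σ k
  set I : Ideal A := Ideal.span (Set.range X) with hI
  have hmap : I.map (algebraMap A S) ≤ IsLocalRing.maximalIdeal S := by
    rw [hI, Ideal.map_span, Ideal.span_le, maximalIdeal_eq_span_X]
    rintro _ ⟨_, ⟨i, rfl⟩, rfl⟩
    exact mem_span_X_iff.2 (hX i)
  have _ : IsLocalRing (S ⧸ Q) := .of_surjective' _ Ideal.Quotient.mk_surjective
  have hmapQ : I.map (algebraMap A (S ⧸ Q)) = (I.map (algebraMap A S)).map (Ideal.Quotient.mk Q) := by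
    rw [Ideal.map_map]; rfl
  have _ : IsHausdorff I (S ⧸ Q) := by
    rw [← IsHausdorff.map_algebraMap_iff (S := S ⧸ Q), hmapQ]
    refine IsHausdorff.of_isLocalRing _ _ fun htop => ?_
    have h1 := congrArg (Ideal.comap (Ideal.Quotient.mk Q)) htop
    rw [Ideal.comap_map_of_surjective _ Ideal.Quotient.mk_surjective, Ideal.comap_top] at h1
    have h2 : I.map (algebraMap A S) ⊔ Ideal.comap (Ideal.Quotient.mk Q) ⊥ ≤
        IsLocalRing.maximalIdeal S := by
      refine sup_le hmap (IsLocalRing.le_maximalIdeal ?_)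
      rw [← RingHom.ker_eq_comap_bot, Ideal.mk_ker]
      exact Ideal.IsPrime.ne_top inferInstance
    rw [h1, top_le_iff] at h2
    exact Ideal.IsPrime.ne_top inferInstance h2
  have hfin : {ν : σ →₀ ℕ | ν.degree < N}.Finite := by
    exact (Finsupp.finite_of_degree_le N).subset fun ν (hν : ν.degree < N) => hν.le
  let ι := {ν : σ →₀ ℕ | ν.degree < N}
  have _ : Fintype ι := hfin.fintype
  have _ : IsPrecomplete I (ι → A) := IsPrecomplete.pi I
  let v : ι → S ⧸ Q := fun ν => Ideal.Quotient.mk Q (monomial ν.1 1)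
  refine Module.Finite.of_surjective (Fintype.linearCombination A v)
    (surjective_of_mkQ_comp_surjective (I := I) ?_)
  intro r
  obtain ⟨r, rfl⟩ := Submodule.mkQ_surjective _ r
  obtain ⟨s, rfl⟩ := Ideal.Quotient.mk_surjective r
  refine ⟨fun ν => algebraMap k A (coeff ν.1 s), ?_⟩
  rw [LinearMap.comp_apply, ← sub_eq_zero, ← map_sub, ← LinearMap.mem_ker, Submodule.ker_mkQ]
  have h1 : Fintype.linearCombination A v (fun ν => algebraMap k A (coeff ν.1 s)) =
      Ideal.Quotient.mk Q ((truncTotal N s : MvPolynomial σ k) : S) := by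
    have h3 : truncTotal N s = ∑ ν : ι, MvPolynomial.monomial ν.1 (coeff ν.1 s) := by
      ext μ
      rw [MvPolynomial.coeff_sum]
      simp only [MvPolynomial.coeff_monomial]
      by_cases hμ : μ.degree < N
      · rw [coeff_truncTotal _ hμ, Finset.sum_eq_single (⟨μ, hμ⟩ : ι)]
        · simp
        · intro b _ hb
          rw [if_neg]
          rintro rfl
          exact hb rfl
        · simp
      · rw [coeff_truncTotal_eq_zero _ (not_lt.1 hμ), Finset.sum_eq_zero]
        intro b _
        rw [if_neg]
        rintro rfl
        exact hμ b.2
    rw [h3, Fintype.linearCombination_apply, ← MvPolynomial.coeToMvPowerSeries.ringHom_apply,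
      map_sum, map_sum]
    refine Finset.sum_congr rfl fun ν _ => ?_
    rw [MvPolynomial.coeToMvPowerSeries.ringHom_apply, MvPolynomial.coe_monomial,
      algebraMap_smul, ← mul_one (coeff ν.1 s), ← smul_eq_mul (coeff ν.1 s), map_smul, smul_eq_mul,
      mul_one]
    rfl
  rw [h1, ← map_sub]
  have h2 : ((truncTotal N s : MvPolynomial σ k) : S) - s ∈ Q ⊔ I.map (algebraMap A S) := by
    rw [← neg_sub]
    exact neg_mem (hN (sub_truncTotal_mem_span_X_pow N s))
  obtain ⟨q, hq, t, ht, hqt⟩ := Submodule.mem_sup.1 h2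
  rw [← hqt, map_add, Ideal.Quotient.eq_zero_iff_mem.2 hq, zero_add]
  have h4 : Ideal.Quotient.mk Q t ∈ I.map (algebraMap A (S ⧸ Q)) := by
    rw [hmapQ]
    exact Ideal.mem_map_of_mem _ ht
  rw [Ideal.smul_top_eq_map]
  exact h4

/-- If a power series ring has at most as many variables as the dimension of a domain which is
finite over it, it embeds in this domain. -/
lemma algebraMap_injective_of_card_le {B : Type*} [CommRing B] [Algebra (MvPowerSeries τ k) B]
    [Module.Finite (MvPowerSeries τ k) B]
    (h : (Nat.card τ : WithBot ℕ∞) ≤ ringKrullDim B) :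
    Function.Injective (algebraMap (MvPowerSeries τ k) B) := by
  rw [injective_iff_map_eq_zero]
  intro p hp
  by_contra hp0
  have h1 : ringKrullDim (MvPowerSeries τ k) ≤ (Nat.card τ : WithBot ℕ∞) := by
    refine (ringKrullDim_le_spanFinrank_maximalIdeal _).trans ?_
    rw [maximalIdeal_eq_span_X]
    have := Submodule.spanFinrank_span_le_ncard_of_finite (R := MvPowerSeries τ k)
      (Set.finite_range (X : τ → MvPowerSeries τ k))
    have h2 : (Set.range (X : τ → MvPowerSeries τ k)).ncard ≤ Nat.card τ := by
      rw [← Nat.card_coe_set_eq]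
      exact Finite.card_range_le _
    exact_mod_cast this.trans h2
  have h2 := ringKrullDim_quotient_succ_le_of_nonZeroDivisor
    (mem_nonZeroDivisors_of_ne_zero hp0)
  have hle : ∀ a ∈ Ideal.span {p}, algebraMap (MvPowerSeries τ k) B a = 0 := by
    intro a ha
    obtain ⟨c, rfl⟩ := Ideal.mem_span_singleton'.1 ha
    rw [map_mul, hp, mul_zero]
  let g : MvPowerSeries τ k ⧸ Ideal.span {p} →+* B := Ideal.Quotient.lift _ (algebraMap _ B) hle
  let _ : Algebra (MvPowerSeries τ k ⧸ Ideal.span {p}) B := g.toAlgebra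
  have hg : (g.comp (Ideal.Quotient.mk (Ideal.span {p}))).IsIntegral :=
    fun b => Algebra.IsIntegral.isIntegral (R := MvPowerSeries τ k) b
  have _ : Algebra.IsIntegral (MvPowerSeries τ k ⧸ Ideal.span {p}) B :=
    ⟨RingHom.IsIntegral.tower_top _ _ hg⟩
  have h3 := ringKrullDim_le_of_isIntegral (MvPowerSeries τ k ⧸ Ideal.span {p}) B
  have h4 : (Nat.card τ : WithBot ℕ∞) + 1 ≤ Nat.card τ :=
    (add_le_add_left (h.trans h3) 1).trans (h2.trans h1)
  have h5 : ((Nat.card τ + 1 : ℕ) : WithBot ℕ∞) ≤ (Nat.card τ : ℕ) := by exact_mod_cast h4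
  have h6 : Nat.card τ + 1 ≤ Nat.card τ := by exact_mod_cast h5
  lia

end MvPowerSeries

lemma Function.Surjective.mem_maximalIdeal_iff {R S : Type*} [CommRing R] [IsLocalRing R]
    [CommRing S] [IsLocalRing S] {f : R →+* S} (hf : Function.Surjective f) (x : R) :
    f x ∈ IsLocalRing.maximalIdeal S ↔ x ∈ IsLocalRing.maximalIdeal R := by
  have := hf.isLocalHom
  simp

namespace IsLocalRing

/-- A Noetherian local ring of dimension `d` has a system of `d` parameters. -/
lemma exists_fin_parameters_of_isNoetherianRing (R : Type*) [CommRing R] [IsNoetherianRing R]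
    [IsLocalRing R] : ∃ (d : ℕ) (y : Fin d → R), (∀ i, y i ∈ maximalIdeal R) ∧
      (∃ N : ℕ, maximalIdeal R ^ N ≤ Ideal.span (Set.range y)) ∧
      ringKrullDim R = (d : WithBot ℕ∞) := by
  obtain ⟨s, hs, hcard⟩ := Ideal.exists_finset_card_eq_height_of_isNoetherianRing (maximalIdeal R)
  have hrange : Set.range (fun i => (s.equivFin.symm i : R)) = s := by
    ext x
    refine ⟨fun ⟨i, hi⟩ => hi ▸ (s.equivFin.symm i).2, fun hx => ⟨s.equivFin ⟨x, hx⟩, by simp⟩⟩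
  refine ⟨s.card, fun i => s.equivFin.symm i,
    fun i => hs.1.2 (Ideal.subset_span (s.equivFin.symm i).2), ?_, ?_⟩
  · rw [hrange]
    refine Ideal.exists_pow_le_of_le_radical_of_fg ?_ (IsNoetherian.noetherian _)
    rw [Ideal.radical_eq_sInf]
    exact le_sInf fun J hJ => hs.2 ⟨hJ.2, hJ.1⟩ (le_maximalIdeal hJ.2.ne_top)
  · rw [← maximalIdeal_height_eq_ringKrullDim, ← hcard]
    rfl

/-- A nonzerodivisor in the maximal ideal of a Noetherian local ring is part of a system of
parameters. -/
lemma exists_fin_parameters {R : Type*} [CommRing R] [IsNoetherianRing R] [IsLocalRing R] {x : R}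
    (hxm : x ∈ maximalIdeal R) (hx : x ∈ nonZeroDivisors R) :
    ∃ (d : ℕ) (y : Fin d → R), (∀ i, y i ∈ maximalIdeal R) ∧
      (∃ N : ℕ, maximalIdeal R ^ N ≤ Ideal.span (insert x (Set.range y))) ∧
      ringKrullDim R = ((d + 1 : ℕ) : WithBot ℕ∞) := by
  have hnt : Nontrivial (R ⧸ Ideal.span {x}) :=
    Ideal.Quotient.nontrivial_iff.2 fun h => hxm (Ideal.span_singleton_eq_top.1 h)
  have hloc : IsLocalRing (R ⧸ Ideal.span {x}) := .of_surjective' _ Ideal.Quotient.mk_surjective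
  obtain ⟨d, y, hy, ⟨N, hN⟩, hd⟩ :=
    exists_fin_parameters_of_isNoetherianRing (R ⧸ Ideal.span {x})
  choose z hz using fun i => Ideal.Quotient.mk_surjective (I := Ideal.span {x}) (y i)
  refine ⟨d, z, fun i => ?_, ⟨N, fun a ha => ?_⟩, ?_⟩
  · rw [← (Ideal.Quotient.mk_surjective (I := Ideal.span {x})).mem_maximalIdeal_iff, hz]
    exact hy i
  · have h1 : Ideal.Quotient.mk (Ideal.span {x}) a ∈ maximalIdeal (R ⧸ Ideal.span {x}) ^ N := by
      have h2 := Ideal.mem_map_of_mem (Ideal.Quotient.mk (Ideal.span {x})) ha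
      rw [Ideal.map_pow] at h2
      refine Ideal.pow_right_mono ?_ N h2
      rw [Ideal.map_le_iff_le_comap]
      exact fun s hs => (Ideal.Quotient.mk_surjective.mem_maximalIdeal_iff s).2 hs
    have h3 := hN h1
    have h4 : Set.range y = Ideal.Quotient.mk (Ideal.span {x}) '' Set.range z := by
      rw [← Set.range_comp]
      congr 1
      exact (funext hz).symm
    rw [h4, ← Ideal.map_span] at h3
    obtain ⟨t, ht, htx⟩ := (Ideal.mem_map_iff_of_surjective _ Ideal.Quotient.mk_surjective).1 h3
    rw [Ideal.span_insert]
    have h5 : a = (a - t) + t := by ring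
    rw [h5]
    exact Submodule.add_mem_sup (Ideal.Quotient.eq.1 htx.symm) ht
  · rw [← ringKrullDim_quotient_span_singleton_succ_eq_ringKrullDim_of_mem_nonZeroDivisors hx hxm,
      hd]
    rfl

end IsLocalRing

namespace MvPowerSeries

variable {σ k : Type*} [Finite σ] [Field k]

/-- Any element of the maximal ideal outside a prime `Q` is part of a system of parameters
modulo `Q`. -/
lemma exists_system_of_parameters (Q : Ideal (MvPowerSeries σ k)) [Q.IsPrime]
    {ρ : MvPowerSeries σ k} (hρ : constantCoeff ρ = 0) (hρQ : ρ ∉ Q) :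
    ∃ (d : ℕ) (y : Fin (d + 1) → MvPowerSeries σ k), y 0 = ρ ∧ (∀ i, constantCoeff (y i) = 0) ∧
      (∃ N : ℕ, Ideal.span (Set.range X) ^ N ≤ Q ⊔ Ideal.span (Set.range y)) ∧
      ((d + 1 : ℕ) : WithBot ℕ∞) ≤ ringKrullDim (MvPowerSeries σ k ⧸ Q) := by
  have hmem : ∀ s : MvPowerSeries σ k,
      s ∈ IsLocalRing.maximalIdeal (MvPowerSeries σ k) ↔ constantCoeff s = 0 := fun s => by
    rw [maximalIdeal_eq_span_X, mem_span_X_iff]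
  have hloc : IsLocalRing (MvPowerSeries σ k ⧸ Q) :=
    .of_surjective' _ Ideal.Quotient.mk_surjective
  have hρ0 : Ideal.Quotient.mk Q ρ ≠ 0 := fun h => hρQ (Ideal.Quotient.eq_zero_iff_mem.1 h)
  have hρm : Ideal.Quotient.mk Q ρ ∈ IsLocalRing.maximalIdeal (MvPowerSeries σ k ⧸ Q) :=
    (Ideal.Quotient.mk_surjective.mem_maximalIdeal_iff ρ).2 ((hmem ρ).2 hρ)
  obtain ⟨d, y, hy, ⟨N, hN⟩, hd⟩ := IsLocalRing.exists_fin_parameters hρm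
    (mem_nonZeroDivisors_of_ne_zero hρ0)
  choose z hz using fun i => Ideal.Quotient.mk_surjective (I := Q) (y i)
  refine ⟨d, Fin.cons ρ z, rfl, fun i => ?_, ⟨N, ?_⟩, ?_⟩
  · refine Fin.cases hρ (fun i => ?_) i
    rw [Fin.cons_succ, ← hmem, ← (Ideal.Quotient.mk_surjective (I := Q)).mem_maximalIdeal_iff, hz]
    exact hy i
  · rw [← maximalIdeal_eq_span_X]
    intro x hx
    have h1 : Ideal.Quotient.mk Q x ∈ IsLocalRing.maximalIdeal (MvPowerSeries σ k ⧸ Q) ^ N := by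
      have h2 := Ideal.mem_map_of_mem (Ideal.Quotient.mk Q) hx
      rw [Ideal.map_pow] at h2
      refine Ideal.pow_right_mono ?_ N h2
      rw [Ideal.map_le_iff_le_comap]
      exact fun s hs => (Ideal.Quotient.mk_surjective.mem_maximalIdeal_iff s).2 hs
    have h3 := hN h1
    have h4 : insert (Ideal.Quotient.mk Q ρ) (Set.range y) =
        Ideal.Quotient.mk Q '' Set.range (Fin.cons ρ z : Fin (d + 1) → MvPowerSeries σ k) := by
      rw [Fin.range_cons, Set.image_insert_eq, ← Set.range_comp]
      congr 2
      exact (funext hz).symm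
    rw [h4, ← Ideal.map_span] at h3
    obtain ⟨t, ht, htx⟩ := (Ideal.mem_map_iff_of_surjective _ Ideal.Quotient.mk_surjective).1 h3
    have h5 : x = (x - t) + t := by ring
    rw [h5]
    exact Submodule.add_mem_sup (Ideal.Quotient.eq.1 htx.symm) ht
  · rw [← hd]

variable [CharZero k]

/-- Noether normalization of a prime quotient of a power series ring, with a prescribed first
parameter `ρ`: the partial derivatives in the parameters extend to the fraction field, they satisfy
the chain rule, and elements killed by some of them divide power series in the parameters killed by
the same ones. -/
lemma exists_normalization (Q : Ideal (MvPowerSeries σ k)) [Q.IsPrime] [Fintype σ]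
    {ρ : MvPowerSeries σ k} (hρ : constantCoeff ρ = 0) (hρQ : ρ ∉ Q) :
    ∃ (d : ℕ) (φ : MvPowerSeries (Fin (d + 1)) k →ₐ[k] MvPowerSeries σ k)
      (D : Fin (d + 1) → Derivation k (FractionRing (MvPowerSeries σ k ⧸ Q))
        (FractionRing (MvPowerSeries σ k ⧸ Q))),
      φ (X 0) = ρ ∧
      (∀ j s, D j (algebraMap _ _ s) = ∑ i, algebraMap _ _ (pderiv k i s) *
        D j (algebraMap (MvPowerSeries σ k) _ (X i))) ∧
      (∀ j, D j (algebraMap (MvPowerSeries σ k) _ ρ) = if j = 0 then 1 else 0) ∧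
      ∀ (T : Finset (Fin (d + 1))) (w : MvPowerSeries σ k), w ∉ Q →
        (∀ j ∈ T, D j (algebraMap _ _ w) = 0) →
        ∃ a, a ≠ 0 ∧ (∀ j ∈ T, pderiv k j a = 0) ∧ ∃ s, φ a - w * s ∈ Q := by
  classical
  obtain ⟨d, y, hy0, hy, ⟨N, hN⟩, hd⟩ := exists_system_of_parameters Q hρ hρQ
  have hsub := hasSubst_of_constantCoeff_zero hy
  let φ : MvPowerSeries (Fin (d + 1)) k →ₐ[k] MvPowerSeries σ k := substAlgHom hsub
  have hφX : ∀ i, φ (X i) = y i := substAlgHom_X hsub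
  let _ : Algebra (MvPowerSeries (Fin (d + 1)) k) (MvPowerSeries σ k) := φ.toRingHom.toAlgebra
  have _ : IsScalarTower k (MvPowerSeries (Fin (d + 1)) k) (MvPowerSeries σ k) :=
    IsScalarTower.of_algebraMap_eq fun c => (φ.commutes c).symm
  have hfin : Module.Finite (MvPowerSeries (Fin (d + 1)) k) (MvPowerSeries σ k ⧸ Q) := by
    refine module_finite_quotient Q (N := N) (fun i => ?_) ?_
    · exact (congrArg constantCoeff (hφX i)).trans (hy i)
    · rw [Ideal.map_span, ← Set.range_comp]
      have : (algebraMap (MvPowerSeries (Fin (d + 1)) k) (MvPowerSeries σ k)) ∘ X = y :=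
        funext hφX
      rw [this]
      exact hN
  have hinj : Function.Injective
      (algebraMap (MvPowerSeries (Fin (d + 1)) k) (MvPowerSeries σ k ⧸ Q)) := by
    refine algebraMap_injective_of_card_le ?_
    rw [Nat.card_eq_fintype_card, Fintype.card_fin]
    exact_mod_cast hd
  set F := FractionRing (MvPowerSeries σ k ⧸ Q) with hF
  have hinjF : Function.Injective (algebraMap (MvPowerSeries (Fin (d + 1)) k) F) := by
    rw [IsScalarTower.algebraMap_eq _ (MvPowerSeries σ k ⧸ Q) F]
    exact (IsFractionRing.injective (MvPowerSeries σ k ⧸ Q) F).comp hinj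
  have _ : IsDomain (MvPowerSeries (Fin (d + 1)) k) := NoZeroDivisors.to_isDomain _
  have _ : FaithfulSMul (MvPowerSeries (Fin (d + 1)) k) F :=
    (faithfulSMul_iff_algebraMap_injective _ _).2 hinjF
  have _ : Algebra.IsAlgebraic (MvPowerSeries (Fin (d + 1)) k) F := by
    have _ : Algebra.IsAlgebraic (MvPowerSeries σ k ⧸ Q) F :=
      IsLocalization.isAlgebraic _ (nonZeroDivisors _)
    exact Algebra.IsAlgebraic.trans _ (MvPowerSeries σ k ⧸ Q) F
  choose D hD using fun j : Fin (d + 1) =>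
    Derivation.exists_extension_of_isAlgebraic (F := F) (pderiv k j)
  obtain ⟨t, ht⟩ := hfin.fg_top
  have hchain : ∀ j s, D j (algebraMap _ F s) = ∑ i, algebraMap _ F (pderiv k i s) *
        D j (algebraMap (MvPowerSeries σ k) F (X i)) := by
    intro j s
    refine derivation_algebraMap_apply (τ := Fin (d + 1))
      (algebraMap (MvPowerSeries σ k ⧸ Q) F '' t) (t.finite_toSet.image _) (fun s => ?_) (D j)
      (fun a => ⟨_, hD j a⟩) s
    have h := Submodule.mem_map_of_mem (f := (IsScalarTower.toAlgHom (MvPowerSeries (Fin (d + 1)) k)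
      (MvPowerSeries σ k ⧸ Q) F).toLinearMap) (p := ⊤) (r := Ideal.Quotient.mk Q s) trivial
    rw [← ht, Submodule.map_span] at h
    exact h
  have hker : ∀ s, algebraMap (MvPowerSeries σ k) F s = 0 ↔ s ∈ Q := by
    intro s
    rw [IsScalarTower.algebraMap_apply _ (MvPowerSeries σ k ⧸ Q) F,
      map_eq_zero_iff _ (IsFractionRing.injective _ F)]
    exact Ideal.Quotient.eq_zero_iff_mem
  refine ⟨d, φ, D, (hφX 0).trans hy0, hchain, fun j => ?_, fun T w hw hDw => ?_⟩
  · have h := hD j (X 0)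
    rw [IsScalarTower.algebraMap_apply _ (MvPowerSeries σ k) F] at h
    have h2 : algebraMap (MvPowerSeries (Fin (d + 1)) k) (MvPowerSeries σ k) (X 0) = ρ :=
      (hφX 0).trans hy0
    rw [h2] at h
    rw [h]
    split_ifs with hj
    · rw [hj, pderiv_X_self, map_one]
    · rw [pderiv_X_of_ne (Ne.symm hj), map_zero]
  · obtain ⟨a, ha0, haT, q, hq⟩ := exists_const_eq_mul_aeval hinjF T D (fun j _ a => hD j a)
      (mt (hker w).1 hw) (Algebra.IsAlgebraic.isAlgebraic _) hDw
    refine ⟨a, ha0, haT, Polynomial.aeval w q, ?_⟩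
    rw [← hker, map_sub, map_mul, ← Polynomial.aeval_algebraMap_apply, ← hq, sub_eq_zero]
    exact (IsScalarTower.algebraMap_apply _ (MvPowerSeries σ k) F a).symm

end MvPowerSeries

namespace MvPowerSeries

variable {σ k : Type*} [Field k]

lemma constantCoeff_eq_zero_of_mem_prime {P : Ideal (MvPowerSeries σ k)} [P.IsPrime]
    {s : MvPowerSeries σ k} (hs : s ∈ P) : constantCoeff s = 0 := by
  by_contra h
  exact Ideal.IsPrime.ne_top ‹_› (Ideal.eq_top_of_isUnit_mem _ hs
    (isUnit_iff_constantCoeff.2 (isUnit_iff_ne_zero.2 h)))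

lemma algebraMap_fractionRing_eq_zero_iff {Q : Ideal (MvPowerSeries σ k)} [Q.IsPrime]
    {s : MvPowerSeries σ k} :
    algebraMap (MvPowerSeries σ k) (FractionRing (MvPowerSeries σ k ⧸ Q)) s = 0 ↔ s ∈ Q := by
  rw [IsScalarTower.algebraMap_apply _ (MvPowerSeries σ k ⧸ Q) _,
    map_eq_zero_iff _ (IsFractionRing.injective _ _)]
  exact Ideal.Quotient.eq_zero_iff_mem

lemma pderiv_sub_C_mul_pow (f ρ : MvPowerSeries σ k) (c : k) (m : ℕ) (i : σ) :
    pderiv k i (f - C c * ρ ^ m) =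
      pderiv k i f - C c * (m : MvPowerSeries σ k) * ρ ^ (m - 1) * pderiv k i ρ := by
  rw [map_sub, Derivation.leibniz, Derivation.leibniz_pow]
  simp only [smul_eq_mul, pderiv_C, nsmul_eq_mul]
  ring

lemma eq_of_sub_C_mul_pow_mem {Q : Ideal (MvPowerSeries σ k)} [Q.IsPrime]
    {f ρ : MvPowerSeries σ k} (hρ : constantCoeff ρ = 0) (hρQ : ρ ∉ Q) {a b : ℕ} {c e : k}
    (hc : c ≠ 0) (he : e ≠ 0) (ha : f - C c * ρ ^ a ∈ Q) (hb : f - C e * ρ ^ b ∈ Q) : a = b := by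
  wlog hab : a < b generalizing a b c e
  · by_contra hne
    exact hne (this he hc hb ha (by omega)).symm
  obtain ⟨r, rfl⟩ := Nat.exists_eq_add_of_lt hab
  have h1 : ρ ^ a * (C c - C e * ρ ^ (r + 1)) ∈ Q := by
    have h2 := Q.sub_mem hb ha
    convert h2 using 1
    ring
  rcases Ideal.IsPrime.mem_or_mem ‹_› h1 with h2 | h2
  · exact absurd (Ideal.IsPrime.mem_of_pow_mem ‹_› _ h2) hρQ
  · have h3 := constantCoeff_eq_zero_of_mem_prime h2
    rw [map_sub, map_mul, map_pow, hρ, pow_succ, mul_zero, mul_zero, sub_zero,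
      constantCoeff_C] at h3
    exact absurd h3 hc

variable [CharZero k]

lemma coeff_eq_zero_of_pderiv_eq_zero {j : σ} {a : MvPowerSeries σ k} (ha : pderiv k j a = 0)
    {ν : σ →₀ ℕ} (hν : ν j ≠ 0) : coeff ν a = 0 := by
  obtain ⟨m, hm⟩ : ∃ m : σ →₀ ℕ, ν = m + Finsupp.single j 1 :=
    ⟨ν - Finsupp.single j 1, (tsub_add_cancel_of_le (by
      rw [Finsupp.single_le_iff]; exact Nat.one_le_iff_ne_zero.2 hν)).symm⟩
  have h := coeff_pderiv (i := j) a m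
  rw [ha, ← hm, map_zero, eq_comm, mul_eq_zero] at h
  exact h.resolve_right (by exact_mod_cast Nat.succ_ne_zero (m j))

variable [Fintype σ]

/-- A power series without constant term vanishes on a prime on which its gradient vanishes. -/
lemma mem_of_pderiv_mem {Q : Ideal (MvPowerSeries σ k)} [Q.IsPrime] {ρ w : MvPowerSeries σ k}
    (hρ : constantCoeff ρ = 0) (hρQ : ρ ∉ Q) (hw : constantCoeff w = 0)
    (h : ∀ i, pderiv k i w ∈ Q) : w ∈ Q := by
  by_contra hwQ
  obtain ⟨d, φ, D, -, hD, -, hφ⟩ := exists_normalization Q hρ hρQ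
  obtain ⟨a, ha0, haT, s, hs⟩ := hφ Finset.univ w hwQ fun j _ => by
    rw [hD]
    refine Finset.sum_eq_zero fun i _ => ?_
    rw [algebraMap_fractionRing_eq_zero_iff.2 (h i), zero_mul]
  have ha : a = C (constantCoeff a) := by
    classical
    ext ν
    rw [coeff_C]
    split_ifs with hν
    · rw [hν, coeff_zero_eq_constantCoeff_apply]
    · obtain ⟨j, hj⟩ := Finsupp.ne_iff.1 hν
      exact coeff_eq_zero_of_pderiv_eq_zero (haT j (Finset.mem_univ j)) hj
  have hc : constantCoeff a ≠ 0 := fun h0 => ha0 (by rw [ha, h0, map_zero])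
  have hu : IsUnit (φ a) := (isUnit_iff_constantCoeff.2 (isUnit_iff_ne_zero.2 hc)).map φ
  have h1 := constantCoeff_eq_zero_of_mem_prime hs
  rw [map_sub, map_mul, hw, zero_mul, sub_zero] at h1
  exact (isUnit_iff_constantCoeff.1 hu).ne_zero h1

/-- If `w` is functionally dependent on `ρ` along the prime `Q` and does not vanish there, then
`ρ` vanishes on each subvariety of `Q` on which `w` does. -/
lemma mem_of_minors_mem {Q P : Ideal (MvPowerSeries σ k)} [Q.IsPrime] [P.IsPrime] (hQP : Q ≤ P)
    {ρ w : MvPowerSeries σ k} (hρ : constantCoeff ρ = 0) (hρQ : ρ ∉ Q) (hw : w ∉ Q)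
    (h : ∀ i l, pderiv k i w * pderiv k l ρ - pderiv k l w * pderiv k i ρ ∈ Q)
    (hwP : w ∈ P) : ρ ∈ P := by
  classical
  obtain ⟨d, φ, D, hφX, hD, hDρ, hφ⟩ := exists_normalization Q hρ hρQ
  obtain ⟨l, hl⟩ : ∃ l, pderiv k l ρ ∉ Q := by
    by_contra! hc
    have h1 := hDρ 0
    rw [hD, if_pos rfl, Finset.sum_eq_zero fun i _ => by
      rw [algebraMap_fractionRing_eq_zero_iff.2 (hc i), zero_mul]] at h1
    exact zero_ne_one h1
  obtain ⟨a, ha0, haT, s, hs⟩ := hφ (Finset.univ.erase 0) w hw fun j hj => by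
    have h1 : algebraMap (MvPowerSeries σ k) (FractionRing (MvPowerSeries σ k ⧸ Q))
          (pderiv k l ρ) * D j (algebraMap _ _ w) =
        algebraMap _ _ (pderiv k l w) * D j (algebraMap _ _ ρ) := by
      rw [hD j w, hD j ρ, Finset.mul_sum, Finset.mul_sum]
      refine Finset.sum_congr rfl fun i _ => ?_
      have h2 := algebraMap_fractionRing_eq_zero_iff.2 (h i l)
      rw [map_sub, map_mul, map_mul, sub_eq_zero] at h2
      linear_combination D j (algebraMap (MvPowerSeries σ k) _ (X i)) * h2
    rw [hDρ j, if_neg (Finset.ne_of_mem_erase hj), mul_zero, mul_eq_zero] at h1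
    exact h1.resolve_left (mt algebraMap_fractionRing_eq_zero_iff.1 hl)
  obtain ⟨m, b, hb, hab⟩ : ∃ (m : ℕ) (b : MvPowerSeries (Fin (d + 1)) k),
      ¬ X 0 ∣ b ∧ a = X 0 ^ m * b := by
    have hex : ∃ m : ℕ, ¬ X 0 ^ m ∣ a := by
      by_contra! hc
      exact ha0 (eq_zero_of_forall_X_pow_dvd hc)
    have hn := Nat.find_spec hex
    obtain ⟨m, hm⟩ := Nat.exists_eq_succ_of_ne_zero
      (fun h0 : Nat.find hex = 0 => hn (by rw [h0, pow_zero]; exact one_dvd a))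
    obtain ⟨b, hb⟩ := not_not.1 (Nat.find_min hex (hm ▸ Nat.lt_succ_self m))
    refine ⟨m, b, fun ⟨e, he⟩ => hn ?_, hb⟩
    exact ⟨e, by rw [hm, hb, he, pow_succ]; ring⟩
  have hX0 : (X 0 : MvPowerSeries (Fin (d + 1)) k) ^ m ≠ 0 := pow_ne_zero _ (prime_X 0).ne_zero
  have hbu : IsUnit b := by
    rw [isUnit_iff_constantCoeff, isUnit_iff_ne_zero]
    intro h0
    refine hb (X_dvd_iff.2 fun ν hν => ?_)
    rcases eq_or_ne ν 0 with rfl | hν0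
    · simpa using h0
    · obtain ⟨j, hj⟩ := Finsupp.ne_iff.1 hν0
      have hj0 : j ≠ 0 := fun h => hj (by rw [h]; exact hν)
      refine coeff_eq_zero_of_pderiv_eq_zero (j := j) ?_ hj
      have h1 := haT j (Finset.mem_erase.2 ⟨hj0, Finset.mem_univ j⟩)
      rw [hab, Derivation.leibniz, Derivation.leibniz_pow, pderiv_X_of_ne hj0.symm] at h1
      simpa [hX0, (prime_X (k := k) (0 : Fin (d + 1))).ne_zero] using h1
  have h1 : φ a ∈ P := by
    have h2 := P.add_mem (hQP hs) (P.mul_mem_right s hwP)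
    rwa [sub_add_cancel] at h2
  rw [hab, map_mul, map_pow, hφX] at h1
  refine Ideal.IsPrime.mem_of_pow_mem ‹_› m ((Ideal.IsPrime.mem_or_mem ‹_› h1).resolve_right ?_)
  exact fun hb => Ideal.IsPrime.ne_top ‹P.IsPrime› (Ideal.eq_top_of_isUnit_mem _ hb (hbu.map φ))

/-- For all but finitely many `m`, the critical locus of `f - c ρ ^ m` is contained in the zero
locus of `ρ`. -/
theorem exists_forall_mem_radical_pderiv {f ρ : MvPowerSeries σ k} (hf : constantCoeff f = 0)
    (hρ : constantCoeff ρ = 0) :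
    ∃ M : ℕ, ∀ m : ℕ, M ≤ m → ∀ c : k, c ≠ 0 →
      ρ ∈ (Ideal.span (Set.range fun i => pderiv k i (f - C c * ρ ^ m))).radical := by
  classical
  let I : Ideal (MvPowerSeries σ k) := Ideal.span (Set.range fun p : σ × σ =>
    pderiv k p.1 f * pderiv k p.2 ρ - pderiv k p.2 f * pderiv k p.1 ρ)
  have hbound : ∀ Q ∈ I.minimalPrimes, ∃ B : ℕ, ∀ m, ∀ c : k, c ≠ 0 → ρ ∉ Q →
      f - C c * ρ ^ m ∈ Q → m ≤ B := by
    intro Q hQ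
    have _ : Q.IsPrime := hQ.1.1
    by_cases h : ∃ m, ∃ c : k, c ≠ 0 ∧ f - C c * ρ ^ m ∈ Q
    · obtain ⟨m, c, hc, hm⟩ := h
      exact ⟨m, fun m' c' hc' hρQ hm' => (eq_of_sub_C_mul_pow_mem hρ hρQ hc' hc hm' hm).le⟩
    · exact ⟨0, fun m c hc _ hm => absurd ⟨m, c, hc, hm⟩ h⟩
  choose! B hB using hbound
  have hfin : I.minimalPrimes.Finite := I.finite_minimalPrimes_of_isNoetherianRing
  obtain ⟨M, hM⟩ := (hfin.image B).bddAbove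
  refine ⟨M + 1, fun m hm c hc => ?_⟩
  rw [Ideal.radical_eq_sInf, Ideal.mem_sInf]
  rintro P ⟨hP, hPprime⟩
  by_contra hρP
  set w := f - C c * ρ ^ m with hw
  have hwd : ∀ i, pderiv k i w ∈ P := fun i => hP (Ideal.subset_span ⟨i, rfl⟩)
  have hminor : ∀ i l, pderiv k i w * pderiv k l ρ - pderiv k l w * pderiv k i ρ =
      pderiv k i f * pderiv k l ρ - pderiv k l f * pderiv k i ρ := fun i l => by
    rw [hw, pderiv_sub_C_mul_pow, pderiv_sub_C_mul_pow]
    ring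
  have hIP : I ≤ P := by
    rw [Ideal.span_le]
    rintro _ ⟨p, rfl⟩
    change pderiv k p.1 f * pderiv k p.2 ρ - pderiv k p.2 f * pderiv k p.1 ρ ∈ P
    rw [← hminor]
    exact P.sub_mem (P.mul_mem_right _ (hwd _)) (P.mul_mem_right _ (hwd _))
  obtain ⟨Q, hQ, hQP⟩ := Ideal.exists_minimalPrimes_le hIP
  have _ : Q.IsPrime := hQ.1.1
  have hρQ : ρ ∉ Q := fun h => hρP (hQP h)
  have hw0 : constantCoeff w = 0 := by
    rw [hw, map_sub, map_mul, map_pow, hf, hρ, zero_pow (by omega), mul_zero, sub_zero]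
  have hwP : w ∈ P := mem_of_pderiv_mem hρ hρP hw0 hwd
  have hwQ : w ∈ Q := by
    by_contra hwQ
    refine hρP (mem_of_minors_mem hQP hρ hρQ hwQ (fun i l => ?_) hwP)
    rw [hminor]
    exact hQ.1.2 (Ideal.subset_span ⟨(i, l), rfl⟩)
  have h1 := hB Q hQ m c hc hρQ hwQ
  have h2 := hM ⟨Q, hQ, rfl⟩
  omega

end MvPowerSeries

section AnalyticTail

open Asymptotics

variable {𝕜 E F : Type*} [NontriviallyNormedField 𝕜] [NormedAddCommGroup E] [NormedSpace 𝕜 E]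
  [NormedAddCommGroup F] [NormedSpace 𝕜 F]

/-- Subtracting a partial sum of the power series removes the terms of low degree. -/
lemma HasFPowerSeriesOnBall.sub_partialSum {f : E → F} {p : FormalMultilinearSeries 𝕜 E F}
    {r : ENNReal} (hf : HasFPowerSeriesOnBall f p 0 r) (n : ℕ) :
    HasFPowerSeriesOnBall (fun y => f y - p.partialSum n y)
      (fun m => if m < n then 0 else p m) 0 r := by
  refine ⟨hf.r_le.trans (FormalMultilinearSeries.radius_le_of_le fun m => ?_), hf.r_pos,
    fun {y} hy => ?_⟩
  · split_ifs <;> simp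
  · have h1 := hf.hasSum hy
    have h2 : HasSum (fun m => if m ∈ Finset.range n then p m fun _ => y else 0)
        (∑ m ∈ Finset.range n, if m ∈ Finset.range n then p m fun _ => y else 0) :=
      hasSum_sum_of_ne_finset_zero fun m hm => if_neg hm
    rw [Finset.sum_congr rfl fun m hm => if_pos hm] at h2
    rw [zero_add] at h1 ⊢
    convert h1.sub h2 using 2 with m
    · by_cases hm : m < n <;> simp [hm]
    · rfl

lemma HasFPowerSeriesAt.fderiv_sub_partialSum_isBigO [CompleteSpace F] {f : E → F}
    {p : FormalMultilinearSeries 𝕜 E F} (hf : HasFPowerSeriesAt f p 0) (n : ℕ) :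
    (fun x => fderiv 𝕜 (fun y => f y - p.partialSum (n + 1) y) x) =O[𝓝 0] fun x => ‖x‖ ^ n := by
  obtain ⟨r, hr⟩ := hf
  have h := (hr.sub_partialSum (n + 1)).fderiv.hasFPowerSeriesAt.isBigO_sub_partialSum_pow n
  refine h.congr_left fun x => ?_
  rw [zero_add, sub_eq_self]
  refine Finset.sum_eq_zero fun m hm => ?_
  exact DFunLike.congr_fun (FormalMultilinearSeries.derivSeries_eq_zero
    (fun m => if m < n + 1 then 0 else p m)
    (if_pos (Nat.succ_lt_succ (Finset.mem_range.1 hm)))) fun _ => x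

end AnalyticTail

namespace MvPolynomial

variable {n : ℕ}

/-- The homogeneous polynomial of the diagonal of a multilinear form. -/
noncomputable def ofMultilinear {m : ℕ}
    (q : ContinuousMultilinearMap ℝ (fun _ : Fin m => EuclideanSpace ℝ (Fin n)) ℝ) :
    MvPolynomial (Fin n) ℝ :=
  ∑ r : Fin m → Fin n, C (q fun j => EuclideanSpace.single (r j) 1) * ∏ j, X (r j)

lemma isHomogeneous_ofMultilinear {m : ℕ}
    (q : ContinuousMultilinearMap ℝ (fun _ : Fin m => EuclideanSpace ℝ (Fin n)) ℝ) :
    (ofMultilinear q).IsHomogeneous m := by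
  refine IsHomogeneous.sum _ _ _ fun r _ => IsHomogeneous.C_mul ?_ _
  simpa using IsHomogeneous.prod Finset.univ (fun j => X (R := ℝ) (r j)) (fun _ => 1)
    fun j _ => isHomogeneous_X ℝ (r j)

lemma eval_ofMultilinear {m : ℕ}
    (q : ContinuousMultilinearMap ℝ (fun _ : Fin m => EuclideanSpace ℝ (Fin n)) ℝ)
    (y : EuclideanSpace ℝ (Fin n)) : eval y (ofMultilinear q) = q fun _ => y := by
  have hy : y = ∑ i, y i • EuclideanSpace.single i (1 : ℝ) := by
    ext j
    simp [Pi.single_apply]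
  conv_rhs => rw [hy, q.map_sum]
  rw [ofMultilinear, map_sum]
  refine Finset.sum_congr rfl fun r _ => ?_
  rw [q.map_smul_univ, map_mul, map_prod, eval_C, smul_eq_mul, mul_comm]
  simp

lemma hasFDerivAt_eval (P : MvPolynomial (Fin n) ℝ) (x : EuclideanSpace ℝ (Fin n)) :
    HasFDerivAt (fun y : EuclideanSpace ℝ (Fin n) => eval y P)
      (∑ i, eval x (pderiv i P) • (EuclideanSpace.proj i : EuclideanSpace ℝ (Fin n) →L[ℝ] ℝ)) x := by
  induction P using MvPolynomial.induction_on with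
  | C a => simpa using hasFDerivAt_const a x
  | add p q hp hq =>
    simp only [map_add, add_smul, Finset.sum_add_distrib]
    exact hp.add hq
  | mul_X p j hp =>
    have hX : HasFDerivAt (fun y : EuclideanSpace ℝ (Fin n) => y j)
        (EuclideanSpace.proj j : EuclideanSpace ℝ (Fin n) →L[ℝ] ℝ) x :=
      (EuclideanSpace.proj j : EuclideanSpace ℝ (Fin n) →L[ℝ] ℝ).hasFDerivAt
    have h := hp.mul hX
    simp only [map_mul, eval_X]
    refine h.congr_fderiv ?_
    rw [Finset.smul_sum, ← Finset.sum_erase_add _ _ (Finset.mem_univ j),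
      ← Finset.sum_erase_add _ _ (Finset.mem_univ j), add_left_comm, smul_smul, ← add_smul]
    congr 1
    · refine Finset.sum_congr rfl fun i hi => ?_
      rw [pderiv_mul, pderiv_X_of_ne (Finset.ne_of_mem_erase hi).symm, smul_smul]
      simp [mul_comm]
    · rw [pderiv_mul, pderiv_X_self]
      simp [mul_comm, add_comm]

lemma exists_norm_eval_le {M : ℕ} {T : MvPolynomial (Fin n) ℝ}
    (hT : ∀ ν : Fin n →₀ ℕ, ν.degree < M → coeff ν T = 0) :
    ∃ K : ℝ, 0 ≤ K ∧ ∀ x : EuclideanSpace ℝ (Fin n), ‖x‖ ≤ 1 → |eval x T| ≤ K * ‖x‖ ^ M := by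
  refine ⟨∑ ν ∈ T.support, |coeff ν T|, Finset.sum_nonneg fun _ _ => abs_nonneg _,
    fun x hx => ?_⟩
  rw [eval_eq, Finset.sum_mul]
  refine (Finset.abs_sum_le_sum_abs _ _).trans (Finset.sum_le_sum fun ν hν => ?_)
  rw [abs_mul]
  refine mul_le_mul_of_nonneg_left ?_ (abs_nonneg _)
  have hM : M ≤ ν.degree := not_lt.1 fun h => mem_support_iff.1 hν (hT ν h)
  refine le_trans ?_ (pow_le_pow_of_le_one (norm_nonneg x) hx hM)
  rw [Finset.abs_prod, Finsupp.degree_apply, ← Finset.prod_pow_eq_pow_sum]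
  refine Finset.prod_le_prod (fun _ _ => abs_nonneg _) fun i _ => ?_
  rw [abs_pow]
  exact pow_le_pow_left₀ (abs_nonneg _) (PiLp.norm_apply_le x i) _

end MvPolynomial

/-- The Taylor series of an analytic function approximates it to all orders in the `C¹` sense. -/
lemma AnalyticAt.exists_taylor_mvPowerSeries {n : ℕ} {f : EuclideanSpace ℝ (Fin n) → ℝ}
    (hf : AnalyticAt ℝ f 0) :
    ∃ F : MvPowerSeries (Fin n) ℝ, MvPowerSeries.constantCoeff F = f 0 ∧
      ∀ M : ℕ, ∃ P : MvPolynomial (Fin n) ℝ,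
        (∀ ν : Fin n →₀ ℕ, ν.degree ≤ M → P.coeff ν = MvPowerSeries.coeff ν F) ∧
        (fun x => fderiv ℝ (fun y => f y - MvPolynomial.eval y P) x) =O[𝓝 0]
          fun x => ‖x‖ ^ M := by
  obtain ⟨p, hp⟩ := hf
  refine ⟨fun ν => (MvPolynomial.ofMultilinear (p ν.degree)).coeff ν, ?_, fun M =>
    ⟨∑ m ∈ Finset.range (M + 1), MvPolynomial.ofMultilinear (p m), fun ν hν => ?_, ?_⟩⟩
  · have h1 : (MvPolynomial.ofMultilinear (p (0 : Fin n →₀ ℕ).degree)).coeff 0 =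
        MvPolynomial.eval (0 : EuclideanSpace ℝ (Fin n))
          (MvPolynomial.ofMultilinear (p (0 : Fin n →₀ ℕ).degree)) := by
      rw [WithLp.ofLp_zero, MvPolynomial.eval_zero]
      rfl
    refine h1.trans ?_
    rw [MvPolynomial.eval_ofMultilinear, ← hp.coeff_zero (fun _ => 0)]
    rfl
  · rw [MvPolynomial.coeff_sum, Finset.sum_eq_single ν.degree]
    · rfl
    · exact fun m _ hm => (MvPolynomial.isHomogeneous_ofMultilinear _).coeff_eq_zero hm.symm
    · exact fun h => absurd (Finset.mem_range.2 (Nat.lt_succ_of_le hν)) h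
  · have h : ∀ y : EuclideanSpace ℝ (Fin n), MvPolynomial.eval y
        (∑ m ∈ Finset.range (M + 1), MvPolynomial.ofMultilinear (p m)) =
          p.partialSum (M + 1) y := fun y => by
      rw [map_sum]
      exact Finset.sum_congr rfl fun m _ => MvPolynomial.eval_ofMultilinear _ _
    simp only [h]
    exact hp.fderiv_sub_partialSum_isBigO M

namespace MvPowerSeries

variable {σ k : Type*} [Finite σ] [CommRing k]

lemma mem_span_X_pow_iff {N : ℕ} {s : MvPowerSeries σ k} :
    s ∈ Ideal.span (Set.range (X : σ → MvPowerSeries σ k)) ^ N ↔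
      ∀ ν : σ →₀ ℕ, ν.degree < N → coeff ν s = 0 := by
  refine ⟨fun hs ν hν => coeff_eq_zero_of_mem_span_X_pow hs hν, fun hs => ?_⟩
  have h := sub_truncTotal_mem_span_X_pow N s
  have h0 : truncTotal N s = 0 := by
    ext ν
    rw [MvPolynomial.coeff_zero]
    by_cases hν : ν.degree < N
    · rw [coeff_truncTotal _ hν, hs ν hν]
    · exact coeff_truncTotal_eq_zero _ (not_lt.1 hν)
  rwa [h0, MvPolynomial.coe_zero, sub_zero] at h

/-- A membership relation between power series and partial derivatives can be truncated to a
relation between polynomials up to terms of high degree. -/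
lemma exists_truncation [Fintype σ] {N M : ℕ} {R : MvPolynomial σ k} {w : MvPowerSeries σ k}
    {W : MvPolynomial σ k}
    (hW : ∀ ν : σ →₀ ℕ, ν.degree ≤ M → W.coeff ν = coeff ν w)
    (h : (R : MvPowerSeries σ k) ^ N ∈ Ideal.span (Set.range fun i => pderiv k i w)) :
    ∃ A : σ → MvPolynomial σ k, ∀ ν : σ →₀ ℕ, ν.degree < M →
      MvPolynomial.coeff ν (R ^ N - ∑ i, A i * MvPolynomial.pderiv i W) = 0 := by
  obtain ⟨a, ha⟩ := (Ideal.mem_span_range_iff_exists_fun).1 h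
  refine ⟨fun i => truncTotal M (a i), fun ν hν => ?_⟩
  rw [← MvPolynomial.coeff_coe]
  refine mem_span_X_pow_iff.1 ?_ ν hν
  rw [← MvPolynomial.coeToMvPowerSeries.ringHom_apply, map_sub, map_pow, map_sum]
  simp only [map_mul, MvPolynomial.coeToMvPowerSeries.ringHom_apply]
  rw [← ha, ← Finset.sum_sub_distrib]
  refine Ideal.sum_mem _ fun i _ => ?_
  have h1 : pderiv k i w - (MvPolynomial.pderiv i W : MvPolynomial σ k) ∈
      Ideal.span (Set.range (X : σ → MvPowerSeries σ k)) ^ M := by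
    rw [mem_span_X_pow_iff]
    intro μ hμ
    rw [map_sub, MvPolynomial.coeff_coe, coeff_pderiv, MvPolynomial.coeff_pderiv, hW, sub_self]
    simpa using hμ
  have h2 : a i * pderiv k i w - truncTotal M (a i) * (MvPolynomial.pderiv i W : MvPolynomial σ k) =
      (a i - truncTotal M (a i)) * pderiv k i w +
        truncTotal M (a i) * (pderiv k i w - (MvPolynomial.pderiv i W : MvPolynomial σ k)) := by
    ring
  rw [h2]
  exact Ideal.add_mem _ (Ideal.mul_mem_right _ _ (sub_truncTotal_mem_span_X_pow _ _))
    (Ideal.mul_mem_left _ _ h1)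

end MvPowerSeries

lemma EuclideanSpace.eval_sum_X_sq {n : ℕ} (y : EuclideanSpace ℝ (Fin n)) :
    MvPolynomial.eval y (∑ i, MvPolynomial.X i ^ 2) = ‖y‖ ^ 2 := by
  simp [EuclideanSpace.real_norm_sq_eq]

/-- **Szafraniec's Lemma (isolated critical point part).**
If `f : ℝⁿ → ℝ` is real analytic on an open neighborhood `U` of `0` with `f 0 = 0`, then
there are constants `C > 0` and `α > 0` such that for every `c ∈ (0, C)` and every integer
`k ≥ α`, the function `g x = f x - c * ‖x‖ ^ (2 * k)` has an isolated critical point at the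
origin: there is `r₀ > 0` with `∇g x ≠ 0` whenever `0 < ‖x‖ < r₀`. -/
theorem szafraniec_isolated_critical_point
    (n : ℕ) (f : EuclideanSpace ℝ (Fin n) → ℝ) (U : Set (EuclideanSpace ℝ (Fin n)))
    (hU : IsOpen U) (h0U : (0 : EuclideanSpace ℝ (Fin n)) ∈ U)
    (hf : AnalyticOn ℝ f U) (hf0 : f 0 = 0) :
    ∃ C > (0 : ℝ), ∃ α > (0 : ℝ), ∀ c : ℝ, 0 < c → c < C → ∀ k : ℕ, (α : ℝ) ≤ k →
      ∃ r₀ > (0 : ℝ), ∀ x : EuclideanSpace ℝ (Fin n), 0 < ‖x‖ → ‖x‖ < r₀ →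
        gradient (fun y => f y - c * ‖y‖ ^ (2 * k)) x ≠ 0 := by
  have hfa : AnalyticAt ℝ f 0 := (hU.analyticOn_iff_analyticOnNhd.1 hf) 0 h0U
  obtain ⟨F, hF0, hF⟩ := hfa.exists_taylor_mvPowerSeries
  let R : MvPolynomial (Fin n) ℝ := ∑ i, MvPolynomial.X i ^ 2
  have hR0 : MvPowerSeries.constantCoeff (R : MvPowerSeries (Fin n) ℝ) = 0 := by
    rw [← MvPowerSeries.coeff_zero_eq_constantCoeff_apply, MvPolynomial.coeff_coe,
      ← MvPolynomial.constantCoeff_eq]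
    simp [R]
  obtain ⟨α, hα⟩ := MvPowerSeries.exists_forall_mem_radical_pderiv (hF0.trans hf0) hR0
  refine ⟨1, one_pos, α + 1, by positivity, fun c hc _ k hk => ?_⟩
  have hαk : α ≤ k := by exact_mod_cast (le_add_of_nonneg_right zero_le_one).trans hk
  obtain ⟨N, hN⟩ := hα k hαk c hc.ne'
  obtain ⟨P, hP, hPO⟩ := hF (2 * N + 1)
  let S : MvPolynomial (Fin n) ℝ := MvPolynomial.C c * R ^ k
  have hcoe : MvPowerSeries.C c * (R : MvPowerSeries (Fin n) ℝ) ^ k =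
      (S : MvPowerSeries (Fin n) ℝ) := by
    simp [S]
  rw [hcoe] at hN
  obtain ⟨A, hA⟩ := MvPowerSeries.exists_truncation (W := P - S) (M := 2 * N + 1) (fun ν hν => by
    rw [MvPolynomial.coeff_sub, map_sub, hP ν hν, MvPolynomial.coeff_coe]) hN
  obtain ⟨K, hK0, hK⟩ := MvPolynomial.exists_norm_eval_le hA
  choose B hB0 hB using fun i => MvPolynomial.exists_norm_eval_le (M := 0) (T := A i)
    fun ν hν => absurd hν (Nat.not_lt_zero _)
  obtain ⟨L, hL0, hL⟩ := hPO.exists_pos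
  rw [Asymptotics.isBigOWith_iff] at hL
  obtain ⟨r, hr, hball⟩ := Metric.eventually_nhds_iff.1
    (hL.and (hfa.eventually_analyticAt.mono fun x hx => hx.differentiableAt))
  set Z := K + ∑ i, B i * L with hZ
  have hZ0 : 0 ≤ Z := add_nonneg hK0 (Finset.sum_nonneg fun i _ => mul_nonneg (hB0 i) hL0.le)
  refine ⟨min (min 1 r) (1 / (Z + 1)), by positivity, fun x hx0 hxr hgrad => ?_⟩
  obtain ⟨⟨hx1, hxr⟩, hxZ⟩ := (lt_min_iff.1 hxr).imp_left lt_min_iff.1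
  obtain ⟨hbound, hdiff⟩ := hball (by rwa [dist_zero_right])
  rw [norm_pow, norm_norm] at hbound
  have hS : (fun y => f y - c * ‖y‖ ^ (2 * k)) =
      fun y : EuclideanSpace ℝ (Fin n) => f y - MvPolynomial.eval y S := by
    funext y
    rw [map_mul, map_pow, MvPolynomial.eval_C, EuclideanSpace.eval_sum_X_sq, pow_mul]
  rw [hS, gradient, map_eq_zero_iff _ (LinearIsometryEquiv.injective _)] at hgrad
  have hfS := (hdiff.hasFDerivAt.sub (MvPolynomial.hasFDerivAt_eval S x)).fderiv
  have hfP := (hdiff.hasFDerivAt.sub (MvPolynomial.hasFDerivAt_eval P x)).fderiv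
  have hpd : ∀ i, |MvPolynomial.eval x (MvPolynomial.pderiv i (P - S))| ≤
      L * ‖x‖ ^ (2 * N + 1) := fun i => by
    have h1 : fderiv ℝ (fun y => f y - MvPolynomial.eval y P) x (EuclideanSpace.single i 1) =
        -MvPolynomial.eval x (MvPolynomial.pderiv i (P - S)) := by
      refine (DFunLike.congr_fun hfP _).trans ?_
      rw [sub_eq_zero.1 (hfS.symm.trans hgrad)]
      simp
    rw [← abs_neg, ← h1]
    refine le_trans ?_ hbound
    simpa using (fderiv ℝ (fun y => f y - MvPolynomial.eval y P) x).le_opNorm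
      (EuclideanSpace.single i 1)
  have hkey : (‖x‖ ^ 2) ^ N ≤ Z * ‖x‖ ^ (2 * N + 1) := by
    have h1 := hK x hx1.le
    rw [map_sub, map_pow, EuclideanSpace.eval_sum_X_sq, map_sum] at h1
    have h2 : |∑ i, MvPolynomial.eval x (A i * MvPolynomial.pderiv i (P - S))| ≤
        (∑ i, B i * L) * ‖x‖ ^ (2 * N + 1) := by
      rw [Finset.sum_mul]
      refine (Finset.abs_sum_le_sum_abs _ _).trans (Finset.sum_le_sum fun i _ => ?_)
      rw [map_mul, abs_mul, mul_assoc]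
      refine mul_le_mul ?_ (hpd i) (abs_nonneg _) (hB0 i)
      simpa using hB i x hx1.le
    rw [hZ, add_mul]
    have h3 := (abs_le.1 h1).2
    have h4 := (abs_le.1 h2).2
    linarith
  rw [← pow_mul, pow_succ] at hkey
  have h1 : 0 < ‖x‖ ^ (2 * N) := by positivity
  have h2 : ‖x‖ * (Z + 1) < 1 := by rwa [lt_div_iff₀ (by positivity)] at hxZ
  nlinarith
end

section
/- Let g : ℝⁿ → ℝ be C¹ with g(0) = 0, having 0 as an isolated critical point, and suppose that for all sufficiently small δ > 0 and all ε' with 0 < ε' ≪ δ, the restriction of g to the sphere S_δ has no critical values in [−ε', ε']. Then the link K = g⁻¹(0) ∩ S_δ is a deformation retract of the tube T = g⁻¹([−ε', ε']) ∩ S_δ; in particular the inclusion K ↪ T is a homotopy equivalence. -/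
open scoped Topology unitInterval

/-- `A` is a (strong) deformation retract of `X` (as subsets of an ambient space `E`). -/
def IsDeformationRetract {E : Type*} [TopologicalSpace E] (A X : Set E) : Prop :=
  A ⊆ X ∧ ∃ H : C(X × I, X),
    (∀ x : X, H (x, 0) = x) ∧
    (∀ x : X, ((H (x, 1) : X) : E) ∈ A) ∧
    (∀ x : X, ((x : E) ∈ A) → ∀ t : I, H (x, t) = x)

open Set Filter
open scoped RealInnerProductSpace

/-- The inclusion of a deformation retract is a homotopy equivalence. -/
theorem IsDeformationRetract.exists_homotopyEquiv {E : Type*} [TopologicalSpace E] {A X : Set E}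
    (h : IsDeformationRetract A X) :
    ∃ e : ContinuousMap.HomotopyEquiv A X, ∀ x, (e.toFun x : E) = x := by
  obtain ⟨hAX, H, H0, H1, HA⟩ := h
  let incl : C(A, X) := ⟨inclusion hAX, continuous_inclusion hAX⟩
  let r : C(X, A) := ⟨fun x => ⟨H (x, 1), H1 x⟩, by fun_prop⟩
  have hri : r.comp incl = ContinuousMap.id A := by
    ext x
    exact congrArg (fun y : X => (y : E)) (HA (inclusion hAX x) x.2 1)
  have hir : (ContinuousMap.id X).Homotopic (incl.comp r) :=
    ⟨{ toFun := fun p => H (p.2, p.1)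
       continuous_toFun := by fun_prop
       map_zero_left := H0
       map_one_left := fun _ => rfl }⟩
  exact ⟨⟨incl, r, hri ▸ ContinuousMap.Homotopic.refl _, hir.symm⟩, fun _ => rfl⟩

/-- A family of strictly decreasing functions on `[-a, a]` which change sign has a unique zero,
which depends continuously on the parameter. -/
theorem exists_continuous_zero_of_strictAntiOn {X : Type*} [TopologicalSpace X] {φ : X → ℝ → ℝ}
    {a : ℝ} (ha : 0 ≤ a) (hφ : ∀ c ∈ Icc (-a) a, Continuous fun x => φ x c)
    (hcont : ∀ x, ContinuousOn (φ x) (Icc (-a) a))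
    (hanti : ∀ x, StrictAntiOn (φ x) (Icc (-a) a))
    (hneg : ∀ x, φ x a ≤ 0) (hpos : ∀ x, 0 ≤ φ x (-a)) :
    ∃ l : X → ℝ, Continuous l ∧ ∀ x, l x ∈ Icc (-a) a ∧ φ x (l x) = 0 := by
  have hex : ∀ x, ∃ c ∈ Icc (-a) a, φ x c = 0 := fun x =>
    intermediate_value_Icc' (by linarith) (hcont x) ⟨hneg x, hpos x⟩
  choose l hl hl0 using hex
  refine ⟨l, continuous_iff_continuousAt.2 fun x => tendsto_order.2 ⟨fun c hc => ?_, fun c hc => ?_⟩,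
    fun x => ⟨hl x, hl0 x⟩⟩
  · by_cases hca : c < -a
    · exact Eventually.of_forall fun y => hca.trans_le (hl y).1
    have hcI : c ∈ Icc (-a) a := ⟨not_lt.1 hca, hc.le.trans (hl x).2⟩
    have hx : 0 < φ x c := hl0 x ▸ hanti x hcI (hl x) hc
    filter_upwards [(hφ c hcI).continuousAt.eventually (lt_mem_nhds hx)] with y hy
    exact ((hanti y).lt_iff_gt (hl y) hcI).1 (by rwa [hl0])
  · by_cases hca : a < c
    · exact Eventually.of_forall fun y => (hl y).2.trans_lt hca
    have hcI : c ∈ Icc (-a) a := ⟨(hl x).1.trans hc.le, not_lt.1 hca⟩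
    have hx : φ x c < 0 := hl0 x ▸ hanti x (hl x) hcI hc
    filter_upwards [(hφ c hcI).continuousAt.eventually (gt_mem_nhds hx)] with y hy
    exact ((hanti y).lt_iff_gt hcI (hl y)).1 (by rwa [hl0])

section Sphere

variable {E : Type*} [NormedAddCommGroup E] [InnerProductSpace ℝ E]

/-- Radial projection onto the sphere of radius `δ` about the origin. -/
noncomputable def radialProj (δ : ℝ) (y : E) : E := (δ / ‖y‖) • y

theorem norm_radialProj {δ : ℝ} (hδ : 0 ≤ δ) {y : E} (hy : y ≠ 0) : ‖radialProj δ y‖ = δ := by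
  rw [radialProj, norm_smul, norm_div, norm_norm, Real.norm_of_nonneg hδ,
    div_mul_cancel₀ _ (norm_ne_zero_iff.2 hy)]

theorem radialProj_of_norm_eq {δ : ℝ} (hδ : 0 < δ) {y : E} (hy : ‖y‖ = δ) :
    radialProj δ y = y := by
  rw [radialProj, hy, div_self hδ.ne', one_smul]

theorem contDiffAt_radialProj (δ : ℝ) {y : E} (hy : y ≠ 0) : ContDiffAt ℝ 1 (radialProj δ) y :=
  (contDiffAt_const.div (contDiffAt_norm ℝ hy) (norm_ne_zero_iff.2 hy)).smul contDiffAt_id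

/-- The derivative of the radial projection at a point of the sphere fixes tangent vectors. -/
theorem fderiv_radialProj_of_inner_eq_zero {δ : ℝ} (hδ : 0 < δ) {x v : E} (hx : ‖x‖ = δ)
    (hv : ⟪x, v⟫ = 0) : fderiv ℝ (radialProj δ) x v = v := by
  have hx0 : x ≠ 0 := norm_ne_zero_iff.1 (hx ▸ hδ.ne')
  have hline : HasDerivAt (fun t : ℝ => x + t • v) v 0 := by
    simpa using ((hasDerivAt_id (0 : ℝ)).smul_const v).const_add x
  have hnorm : HasDerivAt (fun t : ℝ => ‖x + t • v‖) 0 0 := by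
    have h := hline.norm_sq.sqrt (by simpa using hx0)
    simpa [hv, Real.sqrt_sq (norm_nonneg _)] using h
  have hcurve : HasDerivAt (fun t : ℝ => radialProj δ (x + t • v)) v 0 := by
    have h := ((hasDerivAt_const (0 : ℝ) δ).div hnorm (by simpa using hx0)).smul hline
    refine h.congr_deriv ?_
    simp [hx, hδ.ne']
  have hd : HasFDerivAt (radialProj δ) (fderiv ℝ (radialProj δ) x) (x + (0 : ℝ) • v) := by
    simpa using ((contDiffAt_radialProj δ hx0).differentiableAt one_ne_zero).hasFDerivAt
  have hcomp := hd.comp_hasDerivAt (0 : ℝ) hline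
  exact hcomp.unique hcurve

variable [CompleteSpace E]

/-- The gradient of `g`, made tangential to the sphere of radius `δ` at points of that sphere. -/
noncomputable def tangentialGradient (g : E → ℝ) (δ : ℝ) (x : E) : E :=
  gradient g x - (⟪x, gradient g x⟫ / δ ^ 2) • x

theorem continuous_tangentialGradient {g : E → ℝ} (hg : ContDiff ℝ 1 g) (δ : ℝ) :
    Continuous (tangentialGradient g δ) := by
  have h : Continuous (gradient g) :=
    (InnerProductSpace.toDual ℝ E).symm.continuous.comp (hg.continuous_fderiv one_ne_zero)
  unfold tangentialGradient
  fun_prop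

theorem inner_tangentialGradient {g : E → ℝ} {δ : ℝ} (hδ : 0 < δ) {x : E} (hx : ‖x‖ = δ) :
    ⟪x, tangentialGradient g δ x⟫ = 0 := by
  rw [tangentialGradient, inner_sub_right, inner_smul_right, real_inner_self_eq_norm_sq, hx,
    div_mul_cancel₀ _ (by positivity), sub_self]

theorem fderiv_comp_radialProj_tangentialGradient {g : E → ℝ} (hg : ContDiff ℝ 1 g) {δ : ℝ}
    (hδ : 0 < δ) {x : E} (hx : ‖x‖ = δ) :
    fderiv ℝ (g ∘ radialProj δ) x (tangentialGradient g δ x) =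
      ‖tangentialGradient g δ x‖ ^ 2 := by
  have hx0 : x ≠ 0 := norm_ne_zero_iff.1 (hx ▸ hδ.ne')
  have hin := inner_tangentialGradient (g := g) hδ hx
  rw [fderiv_comp x (hg.differentiable one_ne_zero _)
    ((contDiffAt_radialProj δ hx0).differentiableAt one_ne_zero), ContinuousLinearMap.comp_apply,
    fderiv_radialProj_of_inner_eq_zero hδ hx hin, radialProj_of_norm_eq hδ hx,
    ← inner_gradient_left, ← real_inner_self_eq_norm_sq]
  have hgrad : gradient g x =
      tangentialGradient g δ x + (⟪x, gradient g x⟫ / δ ^ 2) • x := by simp [tangentialGradient]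
  rw [hgrad, inner_add_left, real_inner_smul_left, hin, mul_zero, add_zero]

/-- Near a compact set of regular points of the restriction of `g` to the sphere of radius `δ`,
moving along the tangential gradient changes `g ∘ radialProj δ` at a rate bounded below. -/
theorem exists_lt_fderiv_comp_radialProj {g : E → ℝ} (hg : ContDiff ℝ 1 g) {δ : ℝ} (hδ : 0 < δ)
    {K : Set E} (hK : IsCompact K) (hKδ : ∀ x ∈ K, ‖x‖ = δ)
    (hreg : ∀ x ∈ K, ∀ t : ℝ, gradient g x ≠ t • x) :
    ∃ a > 0, ∀ x ∈ K, ∀ c ∈ Icc (-a) a, x - c • tangentialGradient g δ x ≠ 0 ∧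
      a < fderiv ℝ (g ∘ radialProj δ) (x - c • tangentialGradient g δ x)
        (tangentialGradient g δ x) := by
  set W := tangentialGradient g δ with hW
  have hWc : Continuous W := continuous_tangentialGradient hg δ
  have key : ∀ᶠ p : ℝ × ℝ in 𝓝 (0, 0), ∀ x ∈ K, x - p.1 • W x ≠ 0 ∧
      p.2 < fderiv ℝ (g ∘ radialProj δ) (x - p.1 • W x) (W x) := by
    refine hK.eventually_forall_of_forall_eventually fun x hx => ?_
    have hx0 : x ≠ 0 := norm_ne_zero_iff.1 (hKδ x hx ▸ hδ.ne')
    have hWx : W x ≠ 0 := fun h => hreg x hx _ (sub_eq_zero.1 h)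
    have hmove : Continuous fun z : (ℝ × ℝ) × E => z.2 - z.1.1 • W z.2 := by fun_prop
    have hF : ContinuousAt (fderiv ℝ (g ∘ radialProj δ)) x :=
      (hg.contDiffAt.comp x (contDiffAt_radialProj δ hx0)).continuousAt_fderiv one_ne_zero
    have hD : ContinuousAt (fun z : (ℝ × ℝ) × E =>
        fderiv ℝ (g ∘ radialProj δ) (z.2 - z.1.1 • W z.2) (W z.2)) ((0, 0), x) :=
      (ContinuousAt.comp_of_eq hF hmove.continuousAt (by simp)).clm_apply
        (hWc.comp continuous_snd).continuousAt
    refine (hmove.continuousAt.eventually_ne (by simpa using hx0)).and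
      (ContinuousAt.eventually_lt (by fun_prop) hD ?_)
    simp only [zero_smul, sub_zero]
    rw [hW, fderiv_comp_radialProj_tangentialGradient hg hδ (hKδ x hx)]
    exact pow_pos (norm_pos_iff.2 hWx) 2
  obtain ⟨r, hr, hball⟩ := Metric.eventually_nhds_iff.1 key
  refine ⟨r / 2, half_pos hr, fun x hx c hc => hball (y := (c, r / 2)) ?_ x hx⟩
  rw [Prod.dist_eq, Real.dist_0_eq_abs, Real.dist_0_eq_abs, abs_of_pos (half_pos hr)]
  exact max_lt ((abs_le.2 hc).trans_lt (half_lt_self hr)) (half_lt_self hr)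

/-- If the restriction of `g` to the sphere of radius `δ` has no critical point in a compact tube
around its zero set, then the zero set is a deformation retract of every thinner tube. -/
theorem exists_isDeformationRetract_tube [ProperSpace E] {g : E → ℝ} (hg : ContDiff ℝ 1 g) {δ ε : ℝ}
    (hδ : 0 < δ) (hε : 0 < ε)
    (hreg : ∀ x : E, ‖x‖ = δ → g x ∈ Icc (-ε) ε → ∀ t : ℝ, gradient g x ≠ t • x) :
    ∃ ε₀ > 0, ∀ ε' : ℝ, 0 ≤ ε' → ε' < ε₀ →
      IsDeformationRetract {x : E | g x = 0 ∧ ‖x‖ = δ} {x : E | g x ∈ Icc (-ε') ε' ∧ ‖x‖ = δ} := by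
  set W := tangentialGradient g δ
  set F := g ∘ radialProj δ
  have hWc : Continuous W := continuous_tangentialGradient hg δ
  have hK : IsCompact {x : E | g x ∈ Icc (-ε) ε ∧ ‖x‖ = δ} := by
    refine (isCompact_sphere (0 : E) δ).of_isClosed_subset ?_ fun x hx => by simpa using hx.2
    exact (isClosed_Icc.preimage hg.continuous).inter (isClosed_singleton.preimage continuous_norm)
  obtain ⟨a, ha, hbd⟩ := exists_lt_fderiv_comp_radialProj hg hδ hK (fun x hx => hx.2)
    fun x hx => hreg x hx.2 hx.1
  refine ⟨min ε (a * a), lt_min hε (mul_pos ha ha), fun ε' hε'0 hε' => ?_⟩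
  set T := {x : E | g x ∈ Icc (-ε') ε' ∧ ‖x‖ = δ}
  have hle : ε' ≤ ε := (hε'.trans_le (min_le_left _ _)).le
  replace hbd : ∀ x : T, ∀ c ∈ Icc (-a) a, (x : E) - c • W x ≠ 0 ∧
      a < fderiv ℝ F (x - c • W x) (W x) := fun x =>
    hbd x ⟨Icc_subset_Icc (neg_le_neg hle) hle x.2.1, x.2.2⟩
  let φ : T → ℝ → ℝ := fun x c => F (x - c • W x)
  have hφ0 : ∀ x : T, φ x 0 = g x := fun x => by
    simp [φ, F, radialProj_of_norm_eq hδ x.2.2]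
  have hFd : ∀ y : E, y ≠ 0 → DifferentiableAt ℝ F y := fun y hy =>
    (hg.contDiffAt.comp y (contDiffAt_radialProj δ hy)).differentiableAt one_ne_zero
  have hφd : ∀ x : T, ∀ c ∈ Icc (-a) a,
      HasDerivAt (φ x) (-fderiv ℝ F (x - c • W x) (W x)) c := fun x c hc => by
    have hline : HasDerivAt (fun c : ℝ => (x : E) - c • W x) (-W x) c := by
      simpa using ((hasDerivAt_id c).smul_const (W x)).const_sub (x : E)
    have h := (hFd _ (hbd x c hc).1).hasFDerivAt.comp_hasDerivAt c hline
    rwa [map_neg] at h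
  have hφc : ∀ x, ContinuousOn (φ x) (Icc (-a) a) := fun x c hc =>
    (hφd x c hc).continuousAt.continuousWithinAt
  have hanti : ∀ x, StrictAntiOn (φ x) (Icc (-a) a) := fun x => by
    refine strictAntiOn_of_deriv_neg (convex_Icc _ _) (hφc x) fun c hc => ?_
    have hc := interior_subset hc
    rw [(hφd x c hc).deriv]
    linarith [(hbd x c hc).2]
  have hdrop : ∀ x, ∀ c ∈ Icc (-a) a, ∀ d ∈ Icc (-a) a, c ≤ d →
      φ x d - φ x c ≤ -a * (d - c) := fun x => by
    refine (convex_Icc _ _).image_sub_le_mul_sub_of_deriv_le (hφc x)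
      (fun c hc => (hφd x c (interior_subset hc)).differentiableAt.differentiableWithinAt)
      fun c hc => ?_
    have hc := interior_subset hc
    rw [(hφd x c hc).deriv]
    linarith [(hbd x c hc).2]
  have h0 : (0 : ℝ) ∈ Icc (-a) a := ⟨by linarith, ha.le⟩
  have hεa : ε' ≤ a * a := (hε'.trans_le (min_le_right _ _)).le
  obtain ⟨l, hlc, hl⟩ := exists_continuous_zero_of_strictAntiOn (φ := φ) ha.le
    (fun c hc => continuous_iff_continuousAt.2 fun x =>
      ContinuousAt.comp (f := fun x : T => (x : E) - c • W x)
        (hFd _ (hbd x c hc).1).continuousAt (by fun_prop))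
    hφc hanti
    (fun x => by
      have := hdrop x 0 h0 a ⟨by linarith, le_rfl⟩ ha.le
      rw [hφ0] at this
      nlinarith [x.2.1.2])
    (fun x => by
      have := hdrop x (-a) ⟨le_rfl, by linarith⟩ 0 h0 (by linarith)
      rw [hφ0] at this
      nlinarith [x.2.1.1])
  have htl : ∀ (x : T) (t : I), (t : ℝ) * l x ∈ Icc (-a) a := fun x t =>
    (convex_Icc (-a) a).starConvex h0 |>.smul_mem (hl x).1 t.2.1 t.2.2
  have hbetween : ∀ (x : T) (t : I), φ x (t * l x) ∈ Icc (-ε') ε' := fun x t => by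
    have hx := x.2.1
    rw [← hφ0] at hx
    rcases le_total 0 (l x) with hlx | hlx
    · have h₁ := (hanti x).antitoneOn h0 (htl x t) (mul_nonneg t.2.1 hlx)
      have h₂ := (hanti x).antitoneOn (htl x t) (hl x).1 (mul_le_of_le_one_left hlx t.2.2)
      rw [(hl x).2] at h₂
      exact ⟨by linarith, h₁.trans hx.2⟩
    · have h₁ := (hanti x).antitoneOn (htl x t) h0 (mul_nonpos_of_nonneg_of_nonpos t.2.1 hlx)
      have h₂ := (hanti x).antitoneOn (hl x).1 (htl x t) (by nlinarith [t.2.2])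
      rw [(hl x).2] at h₂
      exact ⟨hx.1.trans h₁, by linarith⟩
  have hproj : ∀ p : T × I, (p.1 : E) - (p.2 * l p.1 : ℝ) • W p.1 ≠ 0 := fun p =>
    (hbd p.1 _ (htl p.1 p.2)).1
  refine ⟨fun x hx => ⟨by simpa [hx.1] using hε'0, hx.2⟩,
    ⟨fun p => ⟨radialProj δ (p.1 - (p.2 * l p.1 : ℝ) • W p.1),
      hbetween p.1 p.2, norm_radialProj hδ.le (hproj p)⟩, ?_⟩, ?_, ?_, ?_⟩
  · refine Continuous.subtype_mk (continuous_iff_continuousAt.2 fun p => ?_) _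
    exact ContinuousAt.comp (f := fun p : T × I => (p.1 : E) - (p.2 * l p.1 : ℝ) • W p.1)
      (contDiffAt_radialProj δ (hproj p)).continuousAt (by fun_prop)
  · intro x
    ext1
    simp [radialProj_of_norm_eq hδ x.2.2]
  · intro x
    refine ⟨?_, norm_radialProj hδ.le (hproj (x, 1))⟩
    simpa [φ, F] using (hl x).2
  · intro x hx t
    have hlx : l x = 0 := (hanti x).injOn (hl x).1 h0 (by rw [(hl x).2, hφ0, hx.1])
    ext1
    simp [hlx, radialProj_of_norm_eq hδ x.2.2]

end Sphere

/-- **Link is a deformation retract of the Milnor tube.**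
If `g : ℝⁿ → ℝ` is `C¹`, `g 0 = 0`, `0` is an isolated critical point of `g`, and for all
sufficiently small `δ > 0` and `0 < ε' ≪ δ` the restriction `g|_{S_δ}` has no critical
values in `[-ε', ε']`, then the link `K = g⁻¹(0) ∩ S_δ` is a deformation retract of the
tube `T = g⁻¹([-ε', ε']) ∩ S_δ`; in particular `K ↪ T` is a homotopy equivalence. -/
theorem link_deformation_retract_of_tube
    (n : ℕ) (g : EuclideanSpace ℝ (Fin n) → ℝ)
    (hg : ContDiff ℝ 1 g) (hg0 : g 0 = 0)
    (hiso : ∃ r₀ > (0 : ℝ), ∀ x : EuclideanSpace ℝ (Fin n),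
      0 < ‖x‖ → ‖x‖ < r₀ → gradient g x ≠ 0)
    (hreg : ∃ δ₀ > (0 : ℝ), ∀ δ : ℝ, 0 < δ → δ < δ₀ →
      ∃ ε₀ > (0 : ℝ), ∀ ε' : ℝ, 0 < ε' → ε' < ε₀ →
        ∀ x : EuclideanSpace ℝ (Fin n), ‖x‖ = δ → g x ∈ Set.Icc (-ε') ε' →
          ∀ t : ℝ, gradient g x ≠ t • x) :
    ∃ δ₀ > (0 : ℝ), ∀ δ : ℝ, 0 < δ → δ < δ₀ →
      ∃ ε₀ > (0 : ℝ), ∀ ε' : ℝ, 0 < ε' → ε' < ε₀ →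
        IsDeformationRetract
          ({x : EuclideanSpace ℝ (Fin n) | g x = 0 ∧ ‖x‖ = δ})
          ({x : EuclideanSpace ℝ (Fin n) | g x ∈ Set.Icc (-ε') ε' ∧ ‖x‖ = δ}) ∧
        ∃ e : ContinuousMap.HomotopyEquiv
            {x : EuclideanSpace ℝ (Fin n) | g x = 0 ∧ ‖x‖ = δ}
            {x : EuclideanSpace ℝ (Fin n) | g x ∈ Set.Icc (-ε') ε' ∧ ‖x‖ = δ},
          ∀ x, ((e.toFun x : EuclideanSpace ℝ (Fin n))) = (x : EuclideanSpace ℝ (Fin n)) := by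
  obtain ⟨δ₀, hδ₀, hreg⟩ := hreg
  refine ⟨δ₀, hδ₀, fun δ hδ hδlt => ?_⟩
  obtain ⟨ε₁, hε₁, hreg⟩ := hreg δ hδ hδlt
  obtain ⟨ε₀, hε₀, h⟩ := exists_isDeformationRetract_tube hg hδ (half_pos hε₁)
    (hreg (ε₁ / 2) (half_pos hε₁) (half_lt_self hε₁))
  refine ⟨ε₀, hε₀, fun ε' hε' hlt => ?_⟩
  have hret := h ε' hε'.le hlt
  exact ⟨hret, hret.exists_homotopyEquiv⟩
end

section
/- Let g : ℝⁿ → ℝ be C¹ and suppose that on the compact set M = g⁻¹([a, b]) ∩ B̄_δ (with a < b, b < 0 or a > 0, so 0 ∉ [a,b]) g has no critical points, and g⁻¹([a,b]) meets the sphere S_δ transversally (at each x ∈ S_δ with g(x) ∈ [a,b], ∇g(x) is not parallel to x). Then the level sets g⁻¹(t) ∩ B̄_δ for t ∈ [a, b] are all diffeomorphic, and g : g⁻¹([a,b]) ∩ B̄_δ → [a,b] is a trivial fiber bundle. -/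
open Metric Set Filter Topology
open scoped NNReal

section RealLemmas

variable {u u' : ℝ → ℝ} {a b c : ℝ}

/-- A function with positive derivative at every point of a level cannot drop below that level. -/
theorem le_of_deriv_pos_on_level (hu : ∀ s, HasDerivAt u (u' s) s) {t s₁ s₂ : ℝ}
    (h : ∀ s, u s = t → 0 < u' s) (h₁ : t ≤ u s₁) (hs : s₁ ≤ s₂) : t ≤ u s₂ :=
  image_le_of_deriv_right_lt_deriv_boundary' (f := fun _ ↦ t) (f' := fun _ ↦ 0) (b := s₂)
    continuousOn_const (fun _ _ ↦ hasDerivWithinAt_const ..) h₁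
    (fun x _ ↦ (hu x).continuousAt.continuousWithinAt) (fun x _ ↦ (hu x).hasDerivWithinAt)
    (fun x _ hx ↦ h x hx.symm) (right_mem_Icc.2 hs)

/-- A function with positive derivative at every point of a level attains that level at most once. -/
theorem eq_of_deriv_pos_on_level (hu : ∀ s, HasDerivAt u (u' s) s) {t s₁ s₂ : ℝ}
    (h : ∀ s, u s = t → 0 < u' s) (h₁ : u s₁ = t) (h₂ : u s₂ = t) : s₁ = s₂ := by
  wlog hlt : s₁ < s₂ generalizing s₁ s₂
  · rcases (not_lt.1 hlt).eq_or_lt with h' | h'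
    · exact h'.symm
    · exact (this h₂ h₁ h').symm
  exfalso
  have hslope := (hasDerivAt_iff_tendsto_slope_left_right.1 (hu s₂)).1.eventually
    (lt_mem_nhds (h s₂ h₂))
  obtain ⟨s, hs, hs'⟩ := (hslope.and (Ioo_mem_nhdsLT hlt)).exists
  have hle := le_of_deriv_pos_on_level hu h h₁.ge hs'.1.le
  rw [slope_def_field, h₂, div_pos_iff] at hs
  rcases hs with hs | hs <;> linarith [hs'.2, hs.1, hs.2]

/-- If `u` grows at rate at least `c` while its values lie in `[a, b]`, it reaches every level in
`[u 0, b]` within a time bounded in terms of `a`, `b`, `c`. -/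
theorem exists_eq_of_le_deriv (hu : ∀ s, HasDerivAt u (u' s) s) (hc : 0 < c)
    (h : ∀ s, u s ∈ Icc a b → c ≤ u' s) (ha : a ≤ u 0) {t : ℝ} (ht : u 0 ≤ t) (htb : t ≤ b) :
    ∃ s ∈ Icc 0 (2 * (b - a) / c), u s = t := by
  set S := 2 * (t - u 0) / c with hS
  have hS0 : 0 ≤ S := by have := sub_nonneg.2 ht; positivity
  have hcS : c / 2 * S = t - u 0 := by rw [hS]; field_simp
  have hcont : Continuous u := continuous_iff_continuousAt.2 fun s ↦ (hu s).continuousAt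
  have key : u 0 + c / 2 * S ≤ u S := by
    refine image_le_of_deriv_right_lt_deriv_boundary' (f := fun s ↦ u 0 + c / 2 * s)
      (f' := fun _ ↦ c / 2) (a := 0) (b := S) (by fun_prop) (fun x _ ↦ ?_) (by simp)
      hcont.continuousOn (fun x _ ↦ (hu x).hasDerivWithinAt) (fun x hx hxu ↦ ?_)
      (right_mem_Icc.2 hS0)
    · simpa using (((hasDerivAt_id x).const_mul (c / 2)).const_add (u 0)).hasDerivWithinAt
    · have h0 : 0 ≤ c / 2 * x := mul_nonneg (by positivity) hx.1
      have h1 : c / 2 * x ≤ c / 2 * S := by gcongr; exact hx.2.le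
      have := h x ⟨by linarith, by linarith⟩
      linarith
  obtain ⟨s, hs, hst⟩ := intermediate_value_Icc hS0 hcont.continuousOn
    (show t ∈ Icc (u 0) (u S) from ⟨ht, by linarith⟩)
  refine ⟨s, ⟨hs.1, hs.2.trans ?_⟩, hst⟩
  rw [hS]
  gcongr

/-- Backward-time version of `exists_eq_of_le_deriv`. -/
theorem exists_eq_of_le_deriv_neg (hu : ∀ s, HasDerivAt u (u' s) s) (hc : 0 < c)
    (h : ∀ s, u s ∈ Icc a b → c ≤ u' s) (hb : u 0 ≤ b) {t : ℝ} (ht : t ≤ u 0) (hta : a ≤ t) :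
    ∃ s ∈ Icc 0 (2 * (b - a) / c), u (-s) = t := by
  have hv (s : ℝ) : HasDerivAt (fun s ↦ -u (-s)) (u' (-s)) s := by
    simpa using ((hu (-s)).comp s (hasDerivAt_neg s)).fun_neg
  obtain ⟨s, hs, hst⟩ := exists_eq_of_le_deriv (a := -b) (b := -a) hv hc
    (fun s hs ↦ h (-s) ⟨by linarith [hs.2], by linarith [hs.1]⟩) (by simpa using hb)
    (t := -t) (by simpa using ht) (by simpa using hta)
  refine ⟨s, ?_, by simpa using hst⟩
  convert hs using 3
  ring

end RealLemmas

section Flow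

variable {E : Type*} [NormedAddCommGroup E] [NormedSpace ℝ E] {V : E → E} {K L : ℝ≥0}

/-- A bounded Lipschitz vector field has a global integral curve through every point. -/
theorem LipschitzWith.exists_integralCurve [CompleteSpace E] (hV : LipschitzWith K V)
    (hL : ∀ x, ‖V x‖ ≤ L) (x : E) :
    ∃ γ : ℝ → E, γ 0 = x ∧ ∀ t, HasDerivAt γ (V (γ t)) t := by
  have hloc (T : ℝ) : ∃ α : ℝ → E, α 0 = x ∧ ∀ t ∈ Ioo (-T) T, HasDerivAt α (V (α t)) t := by
    rcases le_or_gt T 0 with hT | hT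
    · exact ⟨fun _ ↦ x, rfl, fun t ht ↦ by linarith [ht.1, ht.2]⟩
    lift T to ℝ≥0 using hT.le
    have hPL : IsPicardLindelof (fun _ ↦ V) (tmin := -T) (tmax := T) ⟨0, by simp⟩ x (L * T) 0 L K :=
      { lipschitzOnWith := fun _ _ ↦ hV.lipschitzOnWith
        continuousOn := fun _ _ ↦ continuousOn_const
        norm_le := fun _ _ _ _ ↦ hL _
        mul_max_le := by simp }
    obtain ⟨α, h0, hα⟩ := hPL.exists_eq_forall_mem_Icc_hasDerivWithinAt₀
    exact ⟨α, h0, fun t ht ↦ (hα t (Ioo_subset_Icc_self ht)).hasDerivAt (Icc_mem_nhds ht.1 ht.2)⟩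
  choose α hα0 hα using hloc
  refine ⟨fun t ↦ α (|t| + 1) t, hα0 _, fun t ↦ ?_⟩
  have heq : (fun s ↦ α (|s| + 1) s) =ᶠ[𝓝 t] α (|t| + 1) := by
    have hmem : ∀ᶠ s in 𝓝 t, |s| < |t| + 1 :=
      continuous_abs.continuousAt.eventually_lt_const (lt_add_one _)
    filter_upwards [hmem] with s hs
    set r := min (|s| + 1) (|t| + 1)
    have hsr : |s| < r := lt_min (lt_add_one _) hs
    have hr0 : 0 < r := (abs_nonneg s).trans_lt hsr
    have hsub {T : ℝ} (hT : r ≤ T) : Ioo (-r) r ⊆ Ioo (-T) T := Ioo_subset_Ioo (by linarith) hT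
    exact ODE_solution_unique_of_mem_Ioo (v := fun _ ↦ V) (s := fun _ ↦ univ) (t₀ := 0)
      (fun _ _ ↦ hV.lipschitzOnWith) ⟨by linarith, hr0⟩
      (fun w hw ↦ ⟨hα _ w (hsub (min_le_left _ _) hw), mem_univ _⟩)
      (fun w hw ↦ ⟨hα _ w (hsub (min_le_right _ _) hw), mem_univ _⟩)
      (by rw [hα0, hα0]) (abs_lt.1 hsr)
  have := hα (|t| + 1) t (abs_lt.1 (lt_add_one _))
  exact this.congr_of_eventuallyEq heq

/-- The global flow of a Lipschitz vector field satisfies the group law. -/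
theorem LipschitzWith.flow_add (hV : LipschitzWith K V) {φ : E → ℝ → E} (h0 : ∀ x, φ x 0 = x)
    (hφ : ∀ x t, HasDerivAt (φ x) (V (φ x t)) t) (x : E) (s t : ℝ) :
    φ (φ x s) t = φ x (s + t) := by
  have := ODE_solution_unique_univ (v := fun _ ↦ V) (s := fun _ ↦ univ) (t₀ := 0)
    (f := φ (φ x s)) (g := fun t ↦ φ x (s + t))
    (fun _ ↦ hV.lipschitzOnWith) (fun t ↦ ⟨hφ _ t, mem_univ _⟩)
    (fun t ↦ ⟨(hφ x (s + t)).comp_const_add s t, mem_univ _⟩) (by simp [h0])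
  exact congrFun this t

/-- The global flow of a Lipschitz vector field is jointly continuous. -/
theorem LipschitzWith.continuousOn_flow (hV : LipschitzWith K V) {φ : E → ℝ → E}
    (h0 : ∀ x, φ x 0 = x) (hφ : ∀ x t, HasDerivAt (φ x) (V (φ x t)) t) (T : ℝ) :
    ContinuousOn (Function.uncurry φ) (univ ×ˢ Icc 0 T) := by
  have hc (x : E) : Continuous (φ x) := continuous_iff_continuousAt.2 fun t ↦ (hφ x t).continuousAt
  refine continuousOn_prod_of_continuousOn_lipschitzOnWith _ (Real.toNNReal (Real.exp (K * T)))
    (fun x _ ↦ (hc x).continuousOn) fun t ht ↦ LipschitzOnWith.of_dist_le_mul fun x _ y _ ↦ ?_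
  have := dist_le_of_trajectories_ODE (v := fun _ ↦ V) (a := 0) (b := T) (fun _ ↦ hV)
    (hc x).continuousOn (fun t _ ↦ (hφ x t).hasDerivWithinAt)
    (hc y).continuousOn (fun t _ ↦ (hφ y t).hasDerivWithinAt) le_rfl t ht
  rw [Real.coe_toNNReal _ (Real.exp_nonneg _), mul_comm]
  simp only [h0, sub_zero] at this
  refine this.trans ?_
  gcongr
  exact ht.2

end Flow

section Trivialization

variable {X : Type*} [TopologicalSpace X] {B : Set X} {g : X → ℝ} {a b : ℝ}

/-- If a flow preserves a compact set `B` and its orbits in `B` cross each level of `g` in `[a, b]`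
exactly once, within bounded time, then `g` is a trivial bundle over `[a, b]`. -/
theorem exists_trivialization_of_flow [T2Space X] (hB : IsCompact B) (hg : Continuous g)
    {φ : X → ℝ → X} (h0 : ∀ x, φ x 0 = x) (hadd : ∀ x s t, φ (φ x s) t = φ x (s + t)) {T : ℝ}
    (hcont : ContinuousOn (Function.uncurry φ) (univ ×ˢ Icc 0 T))
    (hinv : ∀ x ∈ B, ∀ t, φ x t ∈ B) (hab : a ≤ b)
    (hinj : ∀ x ∈ B, ∀ s s', g (φ x s) ∈ Icc a b → g (φ x s') = g (φ x s) → s' = s)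
    (hup : ∀ x ∈ B, g x = a → ∀ t ∈ Icc a b, ∃ s ∈ Icc 0 T, g (φ x s) = t)
    (hdown : ∀ x ∈ B, g x ∈ Icc a b → ∃ s ∈ Icc 0 T, g (φ x (-s)) = a) :
    ∃ Φ : ↥(g ⁻¹' Icc a b ∩ B) ≃ₜ ↥(g ⁻¹' {a} ∩ B) × ↥(Icc a b),
      ∀ x : ↥(g ⁻¹' Icc a b ∩ B), ((Φ x).2 : ℝ) = g x := by
  set D : Set (X × ℝ) := (g ⁻¹' {a} ∩ B) ×ˢ Icc 0 T
  have hD : IsCompact D :=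
    (hB.inter_left (isClosed_singleton.preimage hg)).prod isCompact_Icc
  set N : Set (X × ℝ) := D ∩ (fun z ↦ g (Function.uncurry φ z)) ⁻¹' Icc a b
  have hDsub : D ⊆ univ ×ˢ Icc 0 T := prod_mono_left (subset_univ _)
  have hN : IsCompact N := hD.of_isClosed_subset
    ((hg.comp_continuousOn (hcont.mono hDsub)).preimage_isClosed_of_isClosed
      hD.isClosed isClosed_Icc) inter_subset_left
  have : CompactSpace N := isCompact_iff_compactSpace.1 hN
  have hφN : Continuous fun z : N ↦ φ z.1.1 z.1.2 :=
    continuousOn_iff_continuous_domRestrict.1 (hcont.mono (inter_subset_left.trans hDsub))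
  let e₁ : N → ↥(g ⁻¹' Icc a b ∩ B) := fun z ↦ ⟨φ z.1.1 z.1.2, z.2.2, hinv _ z.2.1.1.2 _⟩
  let e₂ : N → ↥(g ⁻¹' {a} ∩ B) × ↥(Icc a b) :=
    fun z ↦ (⟨z.1.1, z.2.1.1⟩, ⟨g (φ z.1.1 z.1.2), z.2.2⟩)
  have hc₁ : Continuous e₁ := hφN.subtype_mk _
  have hc₂ : Continuous e₂ :=
    (Continuous.subtype_mk (by fun_prop) _).prodMk ((hg.comp hφN).subtype_mk _)
  have hb₁ : Function.Bijective e₁ := by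
    constructor
    · rintro ⟨⟨y, s⟩, ⟨⟨hya, hyB⟩, hs⟩, hys⟩ ⟨⟨y', s'⟩, ⟨⟨hya', hyB'⟩, hs'⟩, hys'⟩ h
      replace h : φ y s = φ y' s' := congrArg Subtype.val h
      have hback : φ y' (s' - s) = y := by
        rw [sub_eq_add_neg, ← hadd, ← h, hadd, add_neg_cancel, h0]
      have hs : s' - s = 0 := by
        refine hinj y' hyB' 0 (s' - s) ?_ ?_
        · rw [h0, mem_singleton_iff.1 hya']
          exact left_mem_Icc.2 hab
        · rw [hback, h0, mem_singleton_iff.1 hya', mem_singleton_iff.1 hya]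
      rw [hs, h0] at hback
      exact Subtype.ext (Prod.ext hback.symm (sub_eq_zero.1 hs).symm)
    · rintro ⟨x, hxg, hxB⟩
      obtain ⟨s, hs, hsa⟩ := hdown x hxB hxg
      have hx : φ (φ x (-s)) s = x := by rw [hadd, neg_add_cancel, h0]
      refine ⟨⟨(φ x (-s), s), ⟨⟨hsa, hinv x hxB _⟩, hs⟩, ?_⟩, Subtype.ext hx⟩
      change g (φ (φ x (-s)) s) ∈ Icc a b
      rwa [hx]
  have hb₂ : Function.Bijective e₂ := by
    constructor
    · rintro ⟨⟨y, s⟩, ⟨⟨hya, hyB⟩, hs⟩, hys⟩ ⟨⟨y', s'⟩, ⟨⟨hya', hyB'⟩, hs'⟩, hys'⟩ h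
      obtain rfl : y = y' := congrArg (fun p ↦ (p.1 : X)) h
      have h2 : g (φ y s) = g (φ y s') := congrArg (fun p ↦ (p.2 : ℝ)) h
      obtain rfl := hinj y hyB s' s hys' h2
      rfl
    · rintro ⟨⟨y, hya, hyB⟩, t, ht⟩
      obtain ⟨s, hs, hst⟩ := hup y hyB hya t ht
      refine ⟨⟨(y, s), ⟨⟨hya, hyB⟩, hs⟩, ?_⟩, Prod.ext rfl (Subtype.ext hst)⟩
      change g (φ y s) ∈ Icc a b
      rwa [hst]
  have hl : CompactSpace ↥(g ⁻¹' Icc a b ∩ B) :=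
    isCompact_iff_compactSpace.1 (hB.inter_left (isClosed_Icc.preimage hg))
  let E₁ := Continuous.homeoOfEquivCompactToT2 (f := Equiv.ofBijective e₁ hb₁) hc₁
  let E₂ := Continuous.homeoOfEquivCompactToT2 (f := Equiv.ofBijective e₂ hb₂) hc₂
  refine ⟨E₁.symm.trans E₂, fun x ↦ ?_⟩
  obtain ⟨z, rfl⟩ := E₁.surjective x
  rw [Homeomorph.trans_apply, Homeomorph.symm_apply_apply]
  rfl

/-- The fibers of a trivial bundle are homeomorphic to the model fiber. -/
theorem nonempty_homeomorph_fiber_of_trivialization {F : Type*} [TopologicalSpace F]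
    (Φ : ↥(g ⁻¹' Icc a b ∩ B) ≃ₜ F × ↥(Icc a b))
    (hΦ : ∀ x : ↥(g ⁻¹' Icc a b ∩ B), ((Φ x).2 : ℝ) = g x) {t : ℝ} (ht : t ∈ Icc a b) :
    Nonempty (↥(g ⁻¹' {t} ∩ B) ≃ₜ F) := by
  have hsub (x : ↥(g ⁻¹' {t} ∩ B)) : g x ∈ Icc a b := by rwa [mem_singleton_iff.1 x.2.1]
  have hval (y : F) : g (Φ.symm (y, ⟨t, ht⟩)) = t := by rw [← hΦ, Φ.apply_symm_apply]
  exact ⟨{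
    toFun := fun x ↦ (Φ ⟨x, hsub x, x.2.2⟩).1
    invFun := fun y ↦ ⟨Φ.symm (y, ⟨t, ht⟩), hval y, (Φ.symm (y, ⟨t, ht⟩)).2.2⟩
    left_inv := fun x ↦ by
      have h : ((Φ ⟨x, hsub x, x.2.2⟩).1, (⟨t, ht⟩ : ↥(Icc a b))) = Φ ⟨x, hsub x, x.2.2⟩ :=
        Prod.ext rfl (Subtype.ext ((mem_singleton_iff.1 x.2.1).symm.trans
          (hΦ ⟨x, hsub x, x.2.2⟩).symm))
      apply Subtype.ext
      simp only [h, Φ.symm_apply_apply]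
    right_inv := fun y ↦ congrArg Prod.fst (Φ.apply_symm_apply (y, ⟨t, ht⟩))
    continuous_toFun := by fun_prop
    continuous_invFun := by fun_prop }⟩

end Trivialization

section TangentField

open scoped InnerProductSpace

variable {E : Type*} [NormedAddCommGroup E] [InnerProductSpace ℝ E]

/-- A nonzero vector `p` at a point `x` of the ball of radius `δ`, not radial if `‖x‖ = δ`, pairs
positively with its modification `δ² p - ⟪p, x⟫ x`, which is tangent to the sphere. -/
theorem inner_sub_inner_smul_pos {δ : ℝ} (hδ : 0 < δ) {p x : E} (hp : p ≠ 0) (hx : ‖x‖ ≤ δ)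
    (hpx : ‖x‖ = δ → ∀ t : ℝ, p ≠ t • x) : 0 < ⟪p, δ ^ 2 • p - ⟪p, x⟫_ℝ • x⟫_ℝ := by
  have hexp : ⟪p, δ ^ 2 • p - ⟪p, x⟫_ℝ • x⟫_ℝ = δ ^ 2 * ‖p‖ ^ 2 - ⟪p, x⟫_ℝ ^ 2 := by
    rw [inner_sub_right, real_inner_smul_right, real_inner_smul_right,
      real_inner_self_eq_norm_sq]
    ring
  rcases hx.lt_or_eq with hlt | heq
  · rw [hexp]
    have hp0 : 0 < ‖p‖ := norm_pos_iff.2 hp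
    have h1 : ⟪p, x⟫_ℝ ^ 2 ≤ (‖p‖ * ‖x‖) ^ 2 :=
      sq_le_sq' (neg_le_of_abs_le (abs_real_inner_le_norm p x)) (real_inner_le_norm p x)
    have h2 : (‖p‖ * ‖x‖) ^ 2 < (‖p‖ * δ) ^ 2 := by gcongr
    linarith [mul_pow ‖p‖ δ 2]
  · have hne : δ ^ 2 • p - ⟪p, x⟫_ℝ • x ≠ 0 := fun h ↦ hpx heq (⟪p, x⟫_ℝ / δ ^ 2) (by
      rw [div_eq_inv_mul, mul_smul, ← sub_eq_zero.1 h, inv_smul_smul₀ (by positivity)])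
    have hsq : ‖δ ^ 2 • p - ⟪p, x⟫_ℝ • x‖ ^ 2 = δ ^ 2 * ⟪p, δ ^ 2 • p - ⟪p, x⟫_ℝ • x⟫_ℝ := by
      rw [hexp, norm_sub_sq_real, norm_smul, norm_smul, real_inner_smul_left,
        real_inner_smul_right, heq, mul_pow, mul_pow, Real.norm_eq_abs, Real.norm_eq_abs, sq_abs,
        sq_abs]
      ring
    exact pos_of_mul_pos_right (hsq ▸ pow_pos (norm_pos_iff.2 hne) 2) (by positivity)

/-- A continuous field `p` that on a compact subset `M` of the ball of radius `δ` is nonzero, and not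
radial on the sphere, admits a compactly supported `C¹` field `V`, tangent to the sphere, such that
`⟪p, V⟫` is bounded below by a positive constant on `M`. -/
theorem exists_contDiff_tangent_field [FiniteDimensional ℝ E] {δ : ℝ} (hδ : 0 < δ) {p : E → E}
    (hp : Continuous p) {M : Set E} (hM : IsCompact M) (hMδ : M ⊆ closedBall 0 δ)
    (hp0 : ∀ x ∈ M, p x ≠ 0) (hpt : ∀ x ∈ M, ‖x‖ = δ → ∀ t : ℝ, p x ≠ t • x) :
    ∃ V : E → E, ContDiff ℝ 1 V ∧ HasCompactSupport V ∧
      (∃ k : E → ℝ, Continuous k ∧ ∀ x, ⟪x, V x⟫_ℝ = k x * (‖x‖ ^ 2 - δ ^ 2)) ∧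
      ∃ c > 0, ∀ x ∈ M, c ≤ ⟪p x, V x⟫_ℝ := by
  set q : E → E := fun x ↦ δ ^ 2 • p x - ⟪p x, x⟫_ℝ • x with hq
  have hqc : Continuous q := by fun_prop
  obtain ⟨m, hm, hmM⟩ := hM.exists_forall_le' (f := fun x ↦ ⟪p x, q x⟫_ℝ) (a := 0)
    (by fun_prop) fun x hx ↦
      inner_sub_inner_smul_pos hδ (hp0 x hx) (by simpa using hMδ hx) (hpt x hx)
  obtain ⟨W, hW, hWp, -⟩ := hp.exists_contDiff_approx (ε := fun x ↦ m / 2 / (1 + ‖q x‖)) 1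
    (continuous_const.div (by fun_prop) fun x ↦ by positivity) (fun x ↦ by positivity)
  replace hW : ContDiff ℝ 1 W := hW
  let χ : ContDiffBump (0 : E) := ⟨δ, δ + 1, hδ, by linarith⟩
  refine ⟨fun x ↦ χ x • (δ ^ 2 • W x - ⟪W x, x⟫_ℝ • x), ?_, χ.hasCompactSupport.smul_right,
    ⟨fun x ↦ -(χ x * ⟪W x, x⟫_ℝ), ?_, fun x ↦ ?_⟩, m / 2, by positivity, fun x hx ↦ ?_⟩
  · exact χ.contDiff.smul ((contDiff_const.smul hW).sub ((hW.inner ℝ contDiff_id).smul contDiff_id))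
  · exact (χ.continuous.mul (hW.continuous.inner continuous_id)).neg
  · simp only [real_inner_smul_right, inner_sub_right, real_inner_self_eq_norm_sq,
      real_inner_comm x]
    ring
  · have hχ : χ x = 1 := χ.one_of_mem_closedBall (hMδ hx)
    have hd : ⟪p x, δ ^ 2 • W x - ⟪W x, x⟫_ℝ • x⟫_ℝ = ⟪p x, q x⟫_ℝ + ⟪q x, W x - p x⟫_ℝ := by
      simp only [hq, real_inner_smul_right, real_inner_smul_left, inner_sub_right, inner_sub_left,
        real_inner_comm x]
      ring
    have hle : |⟪q x, W x - p x⟫_ℝ| ≤ m / 2 := by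
      refine (abs_real_inner_le_norm _ _).trans ?_
      have h1 : ‖W x - p x‖ ≤ m / 2 / (1 + ‖q x‖) := by
        simpa [dist_eq_norm] using (hWp x).le
      calc ‖q x‖ * ‖W x - p x‖ ≤ (1 + ‖q x‖) * (m / 2 / (1 + ‖q x‖)) := by
            gcongr
            linarith
        _ = m / 2 := by field_simp
    simp only [hχ, one_smul, hd]
    linarith [hmM x hx, neg_le_of_abs_le hle]

/-- Solutions of a scalar linear homogeneous equation that start nonpositive stay nonpositive. -/
theorem nonpos_of_hasDerivAt_mul {h k : ℝ → ℝ} (hk : Continuous k)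
    (hh : ∀ t, HasDerivAt h (k t * h t) t) (h0 : h 0 ≤ 0) (t : ℝ) : h t ≤ 0 := by
  set I : ℝ → ℝ := fun t ↦ ∫ s in (0 : ℝ)..t, k s
  have hI (t : ℝ) : HasDerivAt I (k t) t := (hk.integral_hasStrictDerivAt 0 t).hasDerivAt
  have hconst (t : ℝ) : HasDerivAt (fun t ↦ h t * Real.exp (-I t)) 0 t := by
    convert! (hh t).mul (hI t).neg.exp using 1
    ring
  have heq := is_const_of_deriv_eq_zero (fun t ↦ (hconst t).differentiableAt)
    (fun t ↦ (hconst t).deriv) t 0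
  have hle : h t * Real.exp (-I t) ≤ 0 := by
    rw [heq]
    exact mul_nonpos_of_nonpos_of_nonneg h0 (Real.exp_nonneg _)
  exact nonpos_of_mul_nonpos_left hle (Real.exp_pos _)

/-- Integral curves of a field tangent to the sphere of radius `δ` do not leave the ball. -/
theorem norm_le_of_integralCurve {δ : ℝ} (hδ : 0 ≤ δ) {V : E → E} {k : E → ℝ} (hk : Continuous k)
    (hVk : ∀ x, ⟪x, V x⟫_ℝ = k x * (‖x‖ ^ 2 - δ ^ 2)) {γ : ℝ → E}
    (hγ : ∀ t, HasDerivAt γ (V (γ t)) t) (h0 : ‖γ 0‖ ≤ δ) (t : ℝ) : ‖γ t‖ ≤ δ := by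
  have hγc : Continuous γ := continuous_iff_continuousAt.2 fun t ↦ (hγ t).continuousAt
  have hh (t : ℝ) : HasDerivAt (fun t ↦ ‖γ t‖ ^ 2 - δ ^ 2)
      (2 * k (γ t) * (‖γ t‖ ^ 2 - δ ^ 2)) t := by
    convert! (hγ t).norm_sq.sub_const (δ ^ 2) using 1
    rw [hVk]
    ring
  have := nonpos_of_hasDerivAt_mul (k := fun t ↦ 2 * k (γ t)) (by fun_prop) hh
    (sub_nonpos.2 (by gcongr)) t
  exact le_of_sq_le_sq (sub_nonpos.1 this) hδ

end TangentField

open Metric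

/-- **Milnor tube triviality (Ehresmann-type statement).**
If `g : ℝⁿ → ℝ` is `C¹`, `0 ∉ [a, b]`, `g` has no critical points on the compact set
`M = g⁻¹([a,b]) ∩ B̄_δ`, and the tube meets the sphere `S_δ` transversally, then all level
sets `g⁻¹(t) ∩ B̄_δ`, `t ∈ [a,b]`, are homeomorphic to each other, and
`g : M → [a, b]` is a trivial fiber bundle. -/
theorem milnor_tube_trivial
    (n : ℕ) (g : EuclideanSpace ℝ (Fin n) → ℝ) (hg : ContDiff ℝ 1 g)
    (a b : ℝ) (hab : a < b) (h0 : b < 0 ∨ 0 < a) (δ : ℝ) (hδ : 0 < δ)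
    (hnc : ∀ x ∈ g ⁻¹' Set.Icc a b ∩ closedBall (0 : EuclideanSpace ℝ (Fin n)) δ,
      gradient g x ≠ 0)
    (htrans : ∀ x : EuclideanSpace ℝ (Fin n), ‖x‖ = δ → g x ∈ Set.Icc a b →
      ∀ t : ℝ, gradient g x ≠ t • x) :
    (∀ t₁ ∈ Set.Icc a b, ∀ t₂ ∈ Set.Icc a b,
      Nonempty (↥(g ⁻¹' {t₁} ∩ closedBall (0 : EuclideanSpace ℝ (Fin n)) δ) ≃ₜ
        ↥(g ⁻¹' {t₂} ∩ closedBall (0 : EuclideanSpace ℝ (Fin n)) δ))) ∧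
    ∃ Φ : ↥(g ⁻¹' Set.Icc a b ∩ closedBall (0 : EuclideanSpace ℝ (Fin n)) δ) ≃ₜ
        (↥(g ⁻¹' {a} ∩ closedBall (0 : EuclideanSpace ℝ (Fin n)) δ) × ↥(Set.Icc a b)),
      ∀ x : ↥(g ⁻¹' Set.Icc a b ∩ closedBall (0 : EuclideanSpace ℝ (Fin n)) δ),
        ((Φ x).2 : ℝ) = g (x : EuclideanSpace ℝ (Fin n)) := by
  set B := closedBall (0 : EuclideanSpace ℝ (Fin n)) δ with hBdef
  have hgrad : Continuous (gradient g) :=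
    (LinearIsometryEquiv.continuous _).comp (hg.continuous_fderiv one_ne_zero)
  have hBc : IsCompact B := isCompact_closedBall _ _
  obtain ⟨V, hV, hVs, ⟨k, hk, hVk⟩, c, hc, hcV⟩ := exists_contDiff_tangent_field hδ hgrad
    (hBc.inter_left (isClosed_Icc.preimage hg.continuous)) inter_subset_right hnc
    fun x hx hxδ ↦ htrans x hxδ hx.1
  obtain ⟨K, hK⟩ := hV.lipschitzWith_of_hasCompactSupport hVs one_ne_zero
  obtain ⟨L, hL⟩ := hVs.exists_bound_of_continuous hV.continuous
  choose φ hφ0 hφ using hK.exists_integralCurve (L := L.toNNReal)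
    fun x ↦ (hL x).trans (Real.le_coe_toNNReal L)
  have hinv : ∀ x ∈ B, ∀ t, φ x t ∈ B := fun x hx t ↦ by
    rw [hBdef, mem_closedBall_zero_iff] at hx ⊢
    exact norm_le_of_integralCurve hδ.le hk hVk (hφ x) (by rwa [hφ0]) t
  have hu (x : EuclideanSpace ℝ (Fin n)) (s : ℝ) : HasDerivAt (fun s ↦ g (φ x s))
      (inner ℝ (gradient g (φ x s)) (V (φ x s))) s := by
    have := ((hg.differentiable one_ne_zero (φ x s)).hasGradientAt.hasFDerivAt).comp_hasDerivAt s
      (hφ x s)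
    simpa [Function.comp_def] using! this
  have hder (x : EuclideanSpace ℝ (Fin n)) (hx : x ∈ B) (s : ℝ) (hs : g (φ x s) ∈ Icc a b) :
      c ≤ inner ℝ (gradient g (φ x s)) (V (φ x s)) := hcV _ ⟨hs, hinv x hx s⟩
  obtain ⟨Φ, hΦ⟩ := exists_trivialization_of_flow hBc hg.continuous hφ0 (hK.flow_add hφ0 hφ)
    (hK.continuousOn_flow hφ0 hφ (2 * (b - a) / c)) hinv hab.le
    (fun x hx s s' hs hss ↦ eq_of_deriv_pos_on_level (hu x)
      (fun r hr ↦ hc.trans_le (hder x hx r (hr ▸ hs))) hss rfl)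
    (fun x hx hxa t ht ↦ exists_eq_of_le_deriv (hu x) hc (hder x hx)
      (by rw [hφ0, hxa]) (by rw [hφ0, hxa]; exact ht.1) ht.2)
    (fun x hx hxab ↦ exists_eq_of_le_deriv_neg (hu x) hc (hder x hx)
      (by rw [hφ0]; exact hxab.2) (by rw [hφ0]; exact hxab.1) le_rfl)
  refine ⟨fun t₁ ht₁ t₂ ht₂ ↦ ?_, Φ, hΦ⟩
  obtain ⟨e₁⟩ := nonempty_homeomorph_fiber_of_trivialization Φ hΦ ht₁
  obtain ⟨e₂⟩ := nonempty_homeomorph_fiber_of_trivialization Φ hΦ ht₂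
  exact ⟨e₁.trans e₂.symm⟩
end
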